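/- Woodin for strong compactness is a Π¹₁-definable property over V_δ; consequently the first Woodin for strong compactness cardinal is not weakly compact. -/

import Mathlib

/-!
A framework for formalizing large-cardinal notions from
"Woodin for strong compactness cardinals" over the Mathlib model `ZFSet`
of ZFC.  The ambient set-theoretic universe `V` is the type `ZFSet`;
classes are sets `Set ZFSet`; everything is relativised to a "universe
class" `W : Set ZFSet` (the ambient universe being `W = Set.univ`), so
that the same definitions can also be interpreted inside transitive set
models of ZFC (used to express the forcing/consistency results).
-/

namespace WSC

/-! ### First-order formulas in the language of set theory -/

/-- First-order formulas in the language `{∈}`, with `n` free (de Bruijn) variables. -/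
inductive Fml : ℕ → Type where
  | mem {n} : Fin n → Fin n → Fml n
  | eq  {n} : Fin n → Fin n → Fml n
  | not {n} : Fml n → Fml n
  | and {n} : Fml n → Fml n → Fml n
  | ex  {n} : Fml (n + 1) → Fml n

namespace Fml

/-- Realization of a formula over the class `C`, with all quantifiers relativised to `C`. -/
def Realize (C : Set ZFSet) : ∀ {n}, Fml n → (Fin n → ZFSet) → Prop
  | _, .mem i j, v => v i ∈ v j
  | _, .eq i j, v => v i = v j
  | _, .not φ, v => ¬ Realize C φ v
  | _, .and φ ψ, v => Realize C φ v ∧ Realize C ψ v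
  | _, .ex φ, v => ∃ x ∈ C, Realize C φ (Fin.snoc v x)

def or {n} (φ ψ : Fml n) : Fml n := .not (.and (.not φ) (.not ψ))
def imp {n} (φ ψ : Fml n) : Fml n := Fml.or (.not φ) ψ
def iff {n} (φ ψ : Fml n) : Fml n := .and (imp φ ψ) (imp ψ φ)
def all {n} (φ : Fml (n + 1)) : Fml n := .not (.ex (.not φ))

/-- Universal closure. -/
def alls : ∀ {n}, Fml n → Fml 0
  | 0, φ => φ
  | _ + 1, φ => alls (all φ)

/-- Renaming of variables. -/
def rename : ∀ {n m}, (Fin n → Fin m) → Fml n → Fml m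
  | _, _, f, .mem i j => .mem (f i) (f j)
  | _, _, f, .eq i j => .eq (f i) (f j)
  | _, _, f, .not φ => .not (rename f φ)
  | _, _, f, .and φ ψ => .and (rename f φ) (rename f ψ)
  | _, _, f, .ex φ => .ex (rename (Fin.snoc (fun i => (f i).castSucc) (Fin.last _)) φ)

end Fml

/-- A sentence `φ` holds in the class `C`. -/
def Sat (C : Set ZFSet) (φ : Fml 0) : Prop := Fml.Realize C φ (fun i => i.elim0)

/-! ### The ZFC axioms -/

def extAx : Fml 0 :=
  Fml.all (Fml.all (Fml.imp (Fml.all (Fml.iff (.mem 2 0) (.mem 2 1))) (.eq 0 1)))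

def pairAx : Fml 0 := Fml.all (Fml.all (Fml.ex (Fml.and (.mem 0 2) (.mem 1 2))))

def unionAx : Fml 0 :=
  Fml.all (Fml.ex (Fml.all (Fml.all
    (Fml.imp (Fml.and (.mem 2 3) (.mem 3 0)) (.mem 2 1)))))

def powerAx : Fml 0 :=
  Fml.all (Fml.ex (Fml.all
    (Fml.imp (Fml.all (Fml.imp (.mem 3 2) (.mem 3 0))) (.mem 2 1))))

def infAx : Fml 0 :=
  Fml.ex (Fml.and
    (Fml.ex (Fml.and (.mem 1 0) (Fml.all (Fml.not (.mem 2 1)))))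
    (Fml.all (Fml.imp (.mem 1 0)
      (Fml.ex (Fml.and (.mem 2 0)
        (Fml.all (Fml.iff (.mem 3 2) (Fml.or (.mem 3 1) (.eq 3 1)))))))))

def foundAx : Fml 0 :=
  Fml.all (Fml.imp (Fml.ex (.mem 1 0))
    (Fml.ex (Fml.and (.mem 1 0) (Fml.all (Fml.imp (.mem 2 1) (Fml.not (.mem 2 0)))))))

def choiceAx : Fml 0 :=
  Fml.all (Fml.imp
    (Fml.and
      (Fml.all (Fml.imp (.mem 1 0) (Fml.ex (.mem 2 1))))
      (Fml.all (Fml.all (Fml.imp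
        (Fml.and (.mem 1 0) (Fml.and (.mem 2 0) (Fml.ex (Fml.and (.mem 3 1) (.mem 3 2)))))
        (.eq 1 2)))))
    (Fml.ex (Fml.all (Fml.imp (.mem 2 0)
      (Fml.ex (Fml.and (Fml.and (.mem 3 2) (.mem 3 1))
        (Fml.all (Fml.imp (Fml.and (.mem 4 2) (.mem 4 1)) (.eq 4 3)))))))))

/-- An instance of the separation schema, for a formula `φ` with parameters
`0, …, n-1` and distinguished variable `n`. -/
def sepAx (n : ℕ) (φ : Fml (n + 1)) : Fml 0 :=
  Fml.alls ((Fml.ex (Fml.all (Fml.iff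
    (Fml.mem (⟨n + 2, by omega⟩ : Fin (n + 3)) ⟨n + 1, by omega⟩)
    (Fml.and (Fml.mem (⟨n + 2, by omega⟩ : Fin (n + 3)) ⟨n, by omega⟩)
      (Fml.rename (fun i => if h : (i : ℕ) < n then (⟨i, by omega⟩ : Fin (n + 3))
        else ⟨n + 2, by omega⟩) φ))))) : Fml (n + 1))

/-- An instance of the collection schema, for a formula `φ` with parameters
`0, …, n-1` and distinguished variables `n` (input) and `n+1` (output). -/
def collAx (n : ℕ) (φ : Fml (n + 2)) : Fml 0 :=
  let φ' : Fml (n + 4) := Fml.rename (fun i => if h : (i : ℕ) < n then (⟨i, by omega⟩ : Fin (n + 4))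
    else ⟨(i : ℕ) + 2, by have := i.isLt; omega⟩) φ
  Fml.alls ((Fml.ex (Fml.all
    (Fml.imp (Fml.mem (⟨n + 2, by omega⟩ : Fin (n + 3)) ⟨n, by omega⟩)
      (Fml.imp (Fml.ex φ')
        (Fml.ex (Fml.and (Fml.mem (⟨n + 3, by omega⟩ : Fin (n + 4)) ⟨n + 1, by omega⟩) φ')))))) : Fml (n + 1))

/-- The ZFC axioms. -/
def ZFCax : Set (Fml 0) :=
  {extAx, pairAx, unionAx, powerAx, infAx, foundAx, choiceAx} ∪
    (⋃ n, Set.range (sepAx n)) ∪ (⋃ n, Set.range (collAx n))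

/-- A transitive set model of ZFC. -/
def IsZFModel (m : ZFSet) : Prop := m.IsTransitive ∧ ∀ φ ∈ ZFCax, Sat m.toSet φ

/-- A countable transitive model of ZFC. -/
def IsCtm (m : ZFSet) : Prop := IsZFModel m ∧ m.toSet.Countable

/-! ### Basic set-theoretic notions -/

/-- `x` is a (von Neumann) ordinal: a transitive set of transitive sets. -/
def IsOrd (x : ZFSet) : Prop := x.IsTransitive ∧ ∀ y ∈ x, ZFSet.IsTransitive y

/-- `x ≤ y` for ordinals. -/
def oLe (x y : ZFSet) : Prop := x ∈ y ∨ x = y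

/-- `f` is a function with domain `d` (coded as a set of Kuratowski pairs). -/
def IsFuncOn (d f : ZFSet) : Prop :=
  (∀ p ∈ f, ∃ a b : ZFSet, a ∈ d ∧ p = a.pair b) ∧ ∀ a ∈ d, ∃! b : ZFSet, a.pair b ∈ f

/-- All values of the (partial) function `f` lie in `b`. -/
def MapsInto (f b : ZFSet) : Prop := ∀ x y : ZFSet, x.pair y ∈ f → y ∈ b

/-- The function `f` is injective. -/
def InjFun (f : ZFSet) : Prop := ∀ x x' y : ZFSet, x.pair y ∈ f → x'.pair y ∈ f → x = x'

/-- `|a| ≤ |b|`, witnessed by an injection belonging to the universe class `W`. -/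
def SetLeIn (W : Set ZFSet) (a b : ZFSet) : Prop :=
  ∃ f ∈ W, IsFuncOn a f ∧ MapsInto f b ∧ InjFun f

/-- `κ` is a cardinal (relative to the universe class `W`). -/
def IsCardIn (W : Set ZFSet) (κ : ZFSet) : Prop :=
  IsOrd κ ∧ ∀ α ∈ κ, ¬ SetLeIn W κ α

/-- `M` is a transitive class. -/
def TransClass (M : Set ZFSet) : Prop := ∀ x ∈ M, ∀ y : ZFSet, y ∈ x → y ∈ M

/-- An elementary embedding `j : (W, ∈) → (M, ∈)` between two classes. -/
structure ElemEmb (W M : Set ZFSet) where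
  toFun : ZFSet → ZFSet
  maps : ∀ x ∈ W, toFun x ∈ M
  elem : ∀ {n : ℕ} (φ : Fml n) (v : Fin n → ZFSet), (∀ i, v i ∈ W) →
    (Fml.Realize W φ v ↔ Fml.Realize M φ (fun i => toFun (v i)))

/-- `κ` is the critical point of `j`: the least ordinal moved. -/
def IsCrit {W M : Set ZFSet} (j : ElemEmb W M) (κ : ZFSet) : Prop :=
  IsOrd κ ∧ j.toFun κ ≠ κ ∧ ∀ α ∈ κ, j.toFun α = α

/-! ### The rank hierarchy -/

/-- `x ∈ V_lam`. -/
def VMem (lam x : ZFSet) : Prop := x.rank < lam.rank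

/-- `V_lam ⊆ M` (with `V_lam` computed in the universe class `W`). -/
def VInclIn (W M : Set ZFSet) (lam : ZFSet) : Prop := ∀ x ∈ W, VMem lam x → x ∈ M

/-- `A ⊆ V_δ`. -/
def SubV (A δ : ZFSet) : Prop := ∀ x ∈ A, VMem δ x

/-- `A ∩ V_lam = B ∩ V_lam`. -/
def AgreeBelowIn (W : Set ZFSet) (lam A B : ZFSet) : Prop :=
  ∀ x ∈ W, VMem lam x → (x ∈ A ↔ x ∈ B)

/-- `A ∩ lam = B ∩ lam` (for sets of ordinals). -/
def AgreeMem (lam A B : ZFSet) : Prop := ∀ ξ ∈ lam, (ξ ∈ A ↔ ξ ∈ B)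

/-! ### Covering properties -/

/-- `M ⊨ |s| < t`: in `M` there is an injection of `s` into some ordinal `β ∈ t`. -/
def CardLtIn (M : Set ZFSet) (s t : ZFSet) : Prop :=
  ∃ β f : ZFSet, β ∈ t ∧ f ∈ M ∧ IsFuncOn s f ∧ MapsInto f β ∧ InjFun f

/-- `j` satisfies the weak `lam`-covering property (with target class `M`):
there is `s ∈ M` with `j '' lam ⊆ s` and `M ⊨ |s| < j κ`. -/
def WCovers (M : Set ZFSet) (j : ZFSet → ZFSet) (κ lam : ZFSet) : Prop :=
  ∃ s ∈ M, (∀ α ∈ lam, j α ∈ s) ∧ CardLtIn M s (j κ)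

/-- `j` satisfies the (full) `lam`-covering property: every `X ∈ W` with
`X ⊆ M` and `|X| ≤ lam` is covered by some `s ∈ M` with `M ⊨ |s| < j κ`. -/
def CoversIn (W M : Set ZFSet) (j : ZFSet → ZFSet) (κ lam : ZFSet) : Prop :=
  ∀ X ∈ W, X.toSet ⊆ M → SetLeIn W X lam → ∃ s ∈ M, X ⊆ s ∧ CardLtIn M s (j κ)

/-! ### Strongness -/

/-- `κ` is `lam`-strong. -/
def LamStrongIn (W : Set ZFSet) (κ lam : ZFSet) : Prop :=
  ∃ M : Set ZFSet, M ⊆ W ∧ TransClass M ∧ ∃ j : ElemEmb W M,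
    IsCrit j κ ∧ lam ∈ j.toFun κ ∧ VInclIn W M lam

/-- `κ` is `lam`-strong for `A`. -/
def LamStrongForIn (W : Set ZFSet) (κ lam A : ZFSet) : Prop :=
  ∃ M : Set ZFSet, M ⊆ W ∧ TransClass M ∧ ∃ j : ElemEmb W M,
    IsCrit j κ ∧ lam ∈ j.toFun κ ∧ VInclIn W M lam ∧ AgreeBelowIn W lam A (j.toFun A)

/-- `κ` is `<δ`-strong. -/
def LtStrongIn (W : Set ZFSet) (κ δ : ZFSet) : Prop :=
  ∀ lam : ZFSet, oLe κ lam → lam ∈ δ → LamStrongIn W κ lam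

/-- `κ` is `<δ`-strong for `A`. -/
def LtStrongForIn (W : Set ZFSet) (κ δ A : ZFSet) : Prop :=
  ∀ lam : ZFSet, oLe κ lam → lam ∈ δ → LamStrongForIn W κ lam A

/-! ### Strong compactness -/

/-- `κ` is `lam`-strongly compact (there is an embedding with critical point `κ`,
`j κ > lam`, satisfying the weak `lam`-covering property). -/
def LamSCIn (W : Set ZFSet) (κ lam : ZFSet) : Prop :=
  ∃ M : Set ZFSet, M ⊆ W ∧ TransClass M ∧ ∃ j : ElemEmb W M,
    IsCrit j κ ∧ lam ∈ j.toFun κ ∧ WCovers M j.toFun κ lam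

/-- `κ` is `lam`-strongly compact for the set of ordinals `A`: there is a
`lam`-strong compactness embedding `j` (one with the full `lam`-covering
property) with critical point `κ` and `A ∩ lam = j A ∩ lam`. -/
def LamSCForIn (W : Set ZFSet) (κ lam A : ZFSet) : Prop :=
  ∃ M : Set ZFSet, M ⊆ W ∧ TransClass M ∧ ∃ j : ElemEmb W M,
    IsCrit j κ ∧ lam ∈ j.toFun κ ∧ CoversIn W M j.toFun κ lam ∧ AgreeMem lam A (j.toFun A)

/-- `κ` is `<δ`-strongly compact. -/
def LtSCIn (W : Set ZFSet) (κ δ : ZFSet) : Prop :=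
  ∀ lam : ZFSet, oLe κ lam → lam ∈ δ → LamSCIn W κ lam

/-- `κ` is `<δ`-strongly compact for `A`. -/
def LtSCForIn (W : Set ZFSet) (κ δ A : ZFSet) : Prop :=
  ∀ lam : ZFSet, oLe κ lam → lam ∈ δ → LamSCForIn W κ lam A

/-! ### Supercompactness -/

/-- `M` is closed under `lam`-sequences (from the universe class `W`). -/
def SeqClosedIn (W M : Set ZFSet) (lam : ZFSet) : Prop :=
  ∀ f ∈ W, IsFuncOn lam f → (∀ x y : ZFSet, x.pair y ∈ f → y ∈ M) → f ∈ M

/-- `κ` is `lam`-supercompact. -/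
def LamSupercompactIn (W : Set ZFSet) (κ lam : ZFSet) : Prop :=
  ∃ M : Set ZFSet, M ⊆ W ∧ TransClass M ∧ ∃ j : ElemEmb W M,
    IsCrit j κ ∧ lam ∈ j.toFun κ ∧ SeqClosedIn W M lam

/-- `κ` is `lam`-supercompact for `A`. -/
def LamSupercompactForIn (W : Set ZFSet) (κ lam A : ZFSet) : Prop :=
  ∃ M : Set ZFSet, M ⊆ W ∧ TransClass M ∧ ∃ j : ElemEmb W M,
    IsCrit j κ ∧ lam ∈ j.toFun κ ∧ SeqClosedIn W M lam ∧ AgreeBelowIn W lam A (j.toFun A)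

/-- `κ` is `<δ`-supercompact. -/
def LtSupercompactIn (W : Set ZFSet) (κ δ : ZFSet) : Prop :=
  ∀ lam : ZFSet, oLe κ lam → lam ∈ δ → LamSupercompactIn W κ lam

/-- `κ` is `<δ`-supercompact for `A`. -/
def LtSupercompactForIn (W : Set ZFSet) (κ δ A : ZFSet) : Prop :=
  ∀ lam : ZFSet, oLe κ lam → lam ∈ δ → LamSupercompactForIn W κ lam A

/-! ### The global large-cardinal notions -/

/-- `δ` is a Woodin cardinal. -/
def WoodinIn (W : Set ZFSet) (δ : ZFSet) : Prop :=
  IsCardIn W δ ∧ ∀ A ∈ W, SubV A δ → ∃ κ, κ ∈ δ ∧ LtStrongForIn W κ δ A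

/-- `δ` is a Woodin for strong compactness cardinal. -/
def WoodinSCIn (W : Set ZFSet) (δ : ZFSet) : Prop :=
  IsCardIn W δ ∧ ∀ A ∈ W, A ⊆ δ → ∃ κ, κ ∈ δ ∧ LtSCForIn W κ δ A

/-- `δ` is a Vopěnka cardinal. -/
def VopenkaIn (W : Set ZFSet) (δ : ZFSet) : Prop :=
  IsCardIn W δ ∧ ∀ A ∈ W, SubV A δ → ∃ κ, κ ∈ δ ∧ LtSupercompactForIn W κ δ A

/-- `δ` is Woodin and a limit of `<δ`-supercompact cardinals. -/
def WoodinLimSupercompactIn (W : Set ZFSet) (δ : ZFSet) : Prop :=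
  WoodinIn W δ ∧ ∀ α ∈ δ, ∃ κ : ZFSet, α ∈ κ ∧ κ ∈ δ ∧ LtSupercompactIn W κ δ

/-! ### Inaccessibility -/

/-- `δ` is a regular ordinal: the range of any function from a smaller
ordinal into `δ` is bounded. -/
def RegularIn (W : Set ZFSet) (δ : ZFSet) : Prop :=
  IsOrd δ ∧ ∀ α ∈ δ, ∀ f ∈ W, IsFuncOn α f → MapsInto f δ →
    ∃ β ∈ δ, ∀ x y : ZFSet, x.pair y ∈ f → y ∈ β

/-- The power set of `x` relative to `W`. -/
def powersetIn (W : Set ZFSet) (x : ZFSet) : ZFSet := ZFSet.sep (fun z => z ∈ W) x.powerset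

/-- `δ` is a strong limit cardinal. -/
def StrongLimitIn (W : Set ZFSet) (δ : ZFSet) : Prop :=
  IsCardIn W δ ∧ ∀ α ∈ δ, ∃ β ∈ δ, SetLeIn W (powersetIn W α) β

/-- `δ` is inaccessible: an uncountable regular strong limit cardinal. -/
def InaccessibleIn (W : Set ZFSet) (δ : ZFSet) : Prop :=
  ZFSet.omega ∈ δ ∧ IsCardIn W δ ∧ RegularIn W δ ∧ StrongLimitIn W δ

/-! ### Ultrafilters and measurability -/

/-- Relative complement `a \ b`. -/
def zdiff (a b : ZFSet) : ZFSet := ZFSet.sep (fun x => x ∉ b) a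

/-- Intersection `a ∩ b`. -/
def zinter (a b : ZFSet) : ZFSet := ZFSet.sep (fun x => x ∈ b) a

/-- `U` is a nonprincipal `α`-complete ultrafilter on `α`. -/
def IsUfOnIn (W : Set ZFSet) (α U : ZFSet) : Prop :=
  (∀ x ∈ U, x ⊆ α) ∧ α ∈ U ∧ (∅ : ZFSet) ∉ U ∧
  (∀ x ∈ U, ∀ y : ZFSet, y ∈ W → y ⊆ α → x ⊆ y → y ∈ U) ∧
  (∀ x ∈ W, x ⊆ α → (x ∈ U ∨ zdiff α x ∈ U)) ∧
  (∀ β ∈ α, ∀ g ∈ W, IsFuncOn β g → MapsInto g U →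
    ZFSet.sep (fun ξ => ∀ p q : ZFSet, p.pair q ∈ g → ξ ∈ q) α ∈ U) ∧
  (∀ ξ ∈ α, ZFSet.sep (fun x => x = ξ) α ∉ U)

/-- `U` is a normal ultrafilter on `α`: a nonprincipal `α`-complete
ultrafilter closed under diagonal intersections. -/
def IsNormalUfOnIn (W : Set ZFSet) (α U : ZFSet) : Prop :=
  IsUfOnIn W α U ∧
    ∀ g ∈ W, IsFuncOn α g → MapsInto g U →
      ZFSet.sep (fun ξ => ∀ p q : ZFSet, p.pair q ∈ g → p ∈ ξ → ξ ∈ q) α ∈ U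

/-- `α` is a measurable cardinal. -/
def MeasurableIn (W : Set ZFSet) (α : ZFSet) : Prop := ∃ U ∈ W, IsUfOnIn W α U

/-! ### Functions `f : δ → δ` and closure points -/

/-- `f` codes a function from `δ` to `δ`. -/
def FuncSelf (δ f : ZFSet) : Prop := IsFuncOn δ f ∧ MapsInto f δ

/-- `κ` is a closure point of `f`, i.e. `f '' κ ⊆ κ`. -/
def ClosurePt (f κ : ZFSet) : Prop := ∀ x y : ZFSet, x.pair y ∈ f → x ∈ κ → y ∈ κ

/-! ### GCH -/

/-- GCH: for every infinite cardinal `κ`, any family of subsets of `κ` has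
size at most `κ` or size at least that of the full power set of `κ`. -/
def GCHIn (W : Set ZFSet) : Prop :=
  ∀ κ ∈ W, IsCardIn W κ → oLe ZFSet.omega κ →
    ∀ X ∈ W, (∀ z ∈ X, z ⊆ κ) → (SetLeIn W X κ ∨ SetLeIn W (powersetIn W κ) X)

/-! ### Forcing -/

/-- `(P, R)` is a forcing notion (a preordered set, `x.pair y ∈ R` meaning
`x ≤ y`, i.e. `x` is stronger than `y`). -/
def IsPoset (P R : ZFSet) : Prop :=
  (∀ p ∈ P, p.pair p ∈ R) ∧
  (∀ p q r : ZFSet, p.pair q ∈ R → q.pair r ∈ R → p.pair r ∈ R) ∧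
  (∀ x y : ZFSet, x.pair y ∈ R → x ∈ P ∧ y ∈ P)

/-- `G` is an `m`-generic filter on the forcing notion `(P, R) ∈ m`. -/
def IsGenericFilter (m P R G : ZFSet) : Prop :=
  G ⊆ P ∧
  (∀ p ∈ G, ∀ q ∈ P, p.pair q ∈ R → q ∈ G) ∧
  (∀ p ∈ G, ∀ q ∈ G, ∃ r ∈ G, r.pair p ∈ R ∧ r.pair q ∈ R) ∧
  (∀ D ∈ m, (D ⊆ P ∧ ∀ p ∈ P, ∃ q ∈ D, q.pair p ∈ R) → ∃ q, q ∈ G ∧ q ∈ D)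

/-- `n = m[G]` : `n` is a transitive ZFC-model extending `m` and containing
`G`, and is the least such. -/
def IsGenericExt (m G n : ZFSet) : Prop :=
  IsZFModel n ∧ m ⊆ n ∧ G ∈ n ∧
    ∀ n' : ZFSet, IsZFModel n' → m ⊆ n' → G ∈ n' → n ⊆ n'

/-- `n` is a (set-)forcing extension of the transitive model `m`. -/
def IsForcingExt (m n : ZFSet) : Prop :=
  ∃ P R G : ZFSet, P ∈ m ∧ R ∈ m ∧ IsPoset P R ∧
    IsGenericFilter m P R G ∧ IsGenericExt m G n

/-! ### Ambient (full-universe) abbreviations -/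

abbrev LamStrong (κ lam : ZFSet) : Prop := LamStrongIn Set.univ κ lam
abbrev LamStrongFor (κ lam A : ZFSet) : Prop := LamStrongForIn Set.univ κ lam A
abbrev LtStrong (κ δ : ZFSet) : Prop := LtStrongIn Set.univ κ δ
abbrev LtStrongFor (κ δ A : ZFSet) : Prop := LtStrongForIn Set.univ κ δ A
abbrev LamSC (κ lam : ZFSet) : Prop := LamSCIn Set.univ κ lam
abbrev LamSCFor (κ lam A : ZFSet) : Prop := LamSCForIn Set.univ κ lam A
abbrev LtSC (κ δ : ZFSet) : Prop := LtSCIn Set.univ κ δ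
abbrev LtSCFor (κ δ A : ZFSet) : Prop := LtSCForIn Set.univ κ δ A
abbrev LamSupercompact (κ lam : ZFSet) : Prop := LamSupercompactIn Set.univ κ lam
abbrev LtSupercompact (κ δ : ZFSet) : Prop := LtSupercompactIn Set.univ κ δ
abbrev Woodin (δ : ZFSet) : Prop := WoodinIn Set.univ δ
abbrev WoodinSC (δ : ZFSet) : Prop := WoodinSCIn Set.univ δ
abbrev Vopenka (δ : ZFSet) : Prop := VopenkaIn Set.univ δ
abbrev IsCard (κ : ZFSet) : Prop := IsCardIn Set.univ κ
abbrev Inaccessible (δ : ZFSet) : Prop := InaccessibleIn Set.univ δ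
abbrev Covers (M : Set ZFSet) (j : ZFSet → ZFSet) (κ lam : ZFSet) : Prop :=
  CoversIn Set.univ M j κ lam
abbrev VIncl (M : Set ZFSet) (lam : ZFSet) : Prop := VInclIn Set.univ M lam
abbrev AgreeBelow (lam A B : ZFSet) : Prop := AgreeBelowIn Set.univ lam A B
abbrev SeqClosed (M : Set ZFSet) (lam : ZFSet) : Prop := SeqClosedIn Set.univ M lam

/-- First-order formulas in the language `{∈, Ȧ, Ḃ}` with two additional unary
predicate symbols. -/
inductive Fml2 : ℕ → Type where
  | mem {n} : Fin n → Fin n → Fml2 n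
  | eq  {n} : Fin n → Fin n → Fml2 n
  | pA  {n} : Fin n → Fml2 n
  | pB  {n} : Fin n → Fml2 n
  | not {n} : Fml2 n → Fml2 n
  | and {n} : Fml2 n → Fml2 n → Fml2 n
  | ex  {n} : Fml2 (n + 1) → Fml2 n

/-- Realization of such a formula over the structure `(C, ∈, A, B)`. -/
def Fml2.Realize (C A B : Set ZFSet) : ∀ {n}, Fml2 n → (Fin n → ZFSet) → Prop
  | _, .mem i j, v => v i ∈ v j
  | _, .eq i j, v => v i = v j
  | _, .pA i, v => v i ∈ A
  | _, .pB i, v => v i ∈ B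
  | _, .not φ, v => ¬ Fml2.Realize C A B φ v
  | _, .and φ ψ, v => Fml2.Realize C A B φ v ∧ Fml2.Realize C A B ψ v
  | _, .ex φ, v => ∃ x ∈ C, Fml2.Realize C A B φ (Fin.snoc v x)

/-- The class `V_δ`. -/
def VBelow (δ : ZFSet) : Set ZFSet := {x | VMem δ x}

/-- `δ` is weakly compact: it is inaccessible and every Π¹₁ statement
(`∀ B φ(B)` with `φ` first order) true in `(V_δ, ∈, A)` for `A ⊆ V_δ`
reflects to some `(V_α, ∈, A ∩ V_α)` with `α < δ`. -/
def WeaklyCompact (δ : ZFSet) : Prop :=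
  Inaccessible δ ∧
    ∀ (A : Set ZFSet) (φ : Fml2 0), A ⊆ VBelow δ →
      (∀ B : Set ZFSet, B ⊆ VBelow δ → Fml2.Realize (VBelow δ) A B φ (fun i => i.elim0)) →
      ∃ α : ZFSet, IsOrd α ∧ VMem δ α ∧
        ∀ B : Set ZFSet, B ⊆ VBelow α →
          Fml2.Realize (VBelow α) (A ∩ VBelow α) B φ (fun i => i.elim0)

universe u

/-! ### Relations definable uniformly over transitive classes -/

/-- The relation `R C B v` is expressed by one formula (in which `Ȧ` does not matter) over all
structures `(C, ∈, A, B)` with `C` transitive. -/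
class Definable {n : ℕ} (R : Set ZFSet.{u} → Set ZFSet.{u} → (Fin n → ZFSet.{u}) → Prop) :
    Prop where
  out : ∃ φ : Fml2 n, ∀ (C A B : Set ZFSet.{u}) (v : Fin n → ZFSet.{u}), TransClass C →
    (∀ i, v i ∈ C) → (φ.Realize C A B v ↔ R C B v)

/-- The term `x` is one of the variables. -/
class IsVar {n : ℕ} (x : (Fin n → ZFSet.{u}) → ZFSet.{u}) : Prop where
  out : ∃ i, ∀ v, x v = v i

instance {n : ℕ} (i : Fin n) : IsVar (fun v : Fin n → ZFSet.{u} => v i) := ⟨i, fun _ => rfl⟩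

theorem IsVar.mem {n : ℕ} (x : (Fin n → ZFSet.{u}) → ZFSet.{u}) [h : IsVar x] {C : Set ZFSet.{u}}
    {v : Fin n → ZFSet.{u}} (hv : ∀ i, v i ∈ C) : x v ∈ C := by
  obtain ⟨i, hi⟩ := h.out
  exact hi v ▸ hv i

theorem snoc_mem {n : ℕ} {C : Set ZFSet.{u}} {v : Fin n → ZFSet.{u}} (hv : ∀ i, v i ∈ C)
    {x : ZFSet.{u}} (hx : x ∈ C) (i : Fin (n + 1)) :
    (Fin.snoc v x : Fin (n + 1) → ZFSet.{u}) i ∈ C := by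
  refine Fin.lastCases ?_ (fun i => ?_) i
  · simpa using hx
  · simpa using hv i

namespace Definable

variable {n : ℕ} {P Q R : Set ZFSet.{u} → Set ZFSet.{u} → (Fin n → ZFSet.{u}) → Prop}
  {x y z : (Fin n → ZFSet.{u}) → ZFSet.{u}}

theorem congr (hR : Definable R)
    (h : ∀ C B v, TransClass C → (∀ i, v i ∈ C) → (R C B v ↔ P C B v)) : Definable P := by
  obtain ⟨φ, hφ⟩ := hR.out
  exact ⟨φ, fun C A B v hC hv => (hφ C A B v hC hv).trans (h C B v hC hv)⟩

instance mem [hx : IsVar x] [hy : IsVar y] : Definable (fun _ _ v => x v ∈ y v) := by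
  obtain ⟨i, hi⟩ := hx.out
  obtain ⟨j, hj⟩ := hy.out
  exact ⟨.mem i j, fun C A B v _ _ => by simp [Fml2.Realize, hi, hj]⟩

instance eq [hx : IsVar x] [hy : IsVar y] : Definable (fun _ _ v => x v = y v) := by
  obtain ⟨i, hi⟩ := hx.out
  obtain ⟨j, hj⟩ := hy.out
  exact ⟨.eq i j, fun C A B v _ _ => by simp [Fml2.Realize, hi, hj]⟩

instance memB [hx : IsVar x] : Definable (fun _ B v => x v ∈ B) := by
  obtain ⟨i, hi⟩ := hx.out
  exact ⟨.pB i, fun C A B v _ _ => by simp [Fml2.Realize, hi]⟩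

instance not [hP : Definable P] : Definable (fun C B v => ¬ P C B v) := by
  obtain ⟨φ, hφ⟩ := hP.out
  exact ⟨.not φ, fun C A B v hC hv => by simp [Fml2.Realize, hφ C A B v hC hv]⟩

instance and [hP : Definable P] [hQ : Definable Q] : Definable (fun C B v => P C B v ∧ Q C B v) := by
  obtain ⟨φ, hφ⟩ := hP.out
  obtain ⟨ψ, hψ⟩ := hQ.out
  exact ⟨.and φ ψ, fun C A B v hC hv => by
    simp [Fml2.Realize, hφ C A B v hC hv, hψ C A B v hC hv]⟩

instance imp [Definable P] [Definable Q] : Definable (fun C B v => P C B v → Q C B v) :=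
  (inferInstance : Definable fun C B v => ¬ (P C B v ∧ ¬ Q C B v)).congr
    fun C B v _ _ => by tauto

instance or [Definable P] [Definable Q] : Definable (fun C B v => P C B v ∨ Q C B v) :=
  (inferInstance : Definable fun C B v => ¬ (¬ P C B v ∧ ¬ Q C B v)).congr
    fun C B v _ _ => by tauto

instance iff [Definable P] [Definable Q] : Definable (fun C B v => P C B v ↔ Q C B v) :=
  (inferInstance : Definable fun C B v => (P C B v → Q C B v) ∧ (Q C B v → P C B v)).congr
    fun C B v _ _ => by tauto

variable {S : Set ZFSet.{u} → Set ZFSet.{u} → (Fin n → ZFSet.{u}) → ZFSet.{u} → Prop}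

instance ex [hS : Definable (n := n + 1)
    (fun C B v => S C B (fun i => v i.castSucc) (v (Fin.last n)))] :
    Definable (fun C B v => ∃ a ∈ C, S C B v a) := by
  obtain ⟨φ, hφ⟩ := hS.out
  refine ⟨.ex φ, fun C A B v hC hv => ?_⟩
  simp only [Fml2.Realize]
  refine exists_congr fun a => and_congr_right fun ha => ?_
  rw [hφ C A B _ hC (snoc_mem hv ha)]
  simp

instance all [Definable (n := n + 1)
    (fun C B v => S C B (fun i => v i.castSucc) (v (Fin.last n)))] :
    Definable (fun C B v => ∀ a ∈ C, S C B v a) :=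
  (inferInstance : Definable fun C B v => ¬ ∃ a ∈ C, ¬ S C B v a).congr
    fun C B v _ _ => by push Not; rfl

instance bex [hx : IsVar x] [Definable (n := n + 1)
    (fun C B v => S C B (fun i => v i.castSucc) (v (Fin.last n)))] :
    Definable (fun C B v => ∃ a ∈ x v, S C B v a) := by
  have : IsVar (n := n + 1) fun v => x (fun i => v i.castSucc) := by
    obtain ⟨i, hi⟩ := hx.out
    exact ⟨i.castSucc, fun v => hi _⟩
  exact (inferInstance : Definable fun C B v => ∃ a ∈ C, a ∈ x v ∧ S C B v a).congr
    fun C B v hC hv => ⟨fun ⟨a, _, h⟩ => ⟨a, h⟩, fun ⟨a, h⟩ => ⟨a, hC _ (IsVar.mem x hv) a h.1, h⟩⟩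

instance ball [IsVar x] [Definable (n := n + 1)
    (fun C B v => S C B (fun i => v i.castSucc) (v (Fin.last n)))] :
    Definable (fun C B v => ∀ a ∈ x v, S C B v a) :=
  (inferInstance : Definable fun C B v => ¬ ∃ a ∈ x v, ¬ S C B v a).congr
    fun C B v _ _ => by push Not; rfl

instance subset [IsVar x] [IsVar y] : Definable (fun _ _ v => x v ⊆ y v) := by
  obtain ⟨i, hi⟩ := ‹IsVar x›.out
  obtain ⟨j, hj⟩ := ‹IsVar y›.out
  exact (inferInstance : Definable fun _ _ v => ∀ a ∈ v i, a ∈ v j).congr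
    fun C B v _ _ => by rw [hi, hj, ZFSet.subset_def]

instance eqEmpty [IsVar x] : Definable (fun _ _ v => x v = ∅) := by
  obtain ⟨i, hi⟩ := ‹IsVar x›.out
  exact (inferInstance : Definable fun _ _ v => ∀ a ∈ v i, ¬ a = a).congr
    fun C B v _ _ => by rw [hi, ZFSet.eq_empty]; simp

instance eqInsert [IsVar x] [IsVar y] [IsVar z] :
    Definable (fun _ _ v => x v = insert (y v) (z v)) := by
  obtain ⟨i, hi⟩ := ‹IsVar x›.out
  obtain ⟨j, hj⟩ := ‹IsVar y›.out
  obtain ⟨k, hk⟩ := ‹IsVar z›.out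
  exact (inferInstance : Definable fun _ _ v =>
      (∀ a ∈ v i, a = v j ∨ a ∈ v k) ∧ v j ∈ v i ∧ v k ⊆ v i).congr
    fun C B v _ _ => by
      rw [hi, hj, hk]
      constructor
      · rintro ⟨h, h', h''⟩
        ext a
        rw [ZFSet.mem_insert_iff]
        exact ⟨h a, fun h => h.elim (fun e => e ▸ h') fun h => h'' h⟩
      · intro h
        rw [h]
        exact ⟨fun a => by simp, by simp, fun a => by simp +contextual⟩

theorem eq_pair_iff {a b c : ZFSet.{u}} : a = ZFSet.pair b c ↔
    (∃ d ∈ a, b ∈ d ∧ ∀ t ∈ d, t = b) ∧ (∃ d ∈ a, b ∈ d ∧ c ∈ d ∧ ∀ t ∈ d, t = b ∨ t = c) ∧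
    ∀ d ∈ a, (b ∈ d ∧ ∀ t ∈ d, t = b) ∨ (b ∈ d ∧ c ∈ d ∧ ∀ t ∈ d, t = b ∨ t = c) := by
  have h1 : ∀ d : ZFSet.{u}, (b ∈ d ∧ ∀ t ∈ d, t = b) ↔ d = {b} := fun d =>
    ⟨fun ⟨h, h'⟩ => by
      ext t; rw [ZFSet.mem_singleton]; exact ⟨h' t, fun e => e ▸ h⟩, fun h => by simp [h]⟩
  have h2 : ∀ d : ZFSet.{u}, (b ∈ d ∧ c ∈ d ∧ ∀ t ∈ d, t = b ∨ t = c) ↔ d = {b, c} := fun d =>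
    ⟨fun ⟨h, h', h''⟩ => by
      ext t; rw [ZFSet.mem_pair]
      exact ⟨h'' t, fun e => e.elim (fun e => e ▸ h) (fun e => e ▸ h')⟩, fun h => by simp [h]⟩
  simp only [h1, h2]
  constructor
  · rintro rfl; simp [ZFSet.pair]
  · rintro ⟨⟨_, h, rfl⟩, ⟨_, h', rfl⟩, h''⟩
    ext d
    rw [ZFSet.pair, ZFSet.mem_pair]
    exact ⟨h'' d, fun e => e.elim (fun e => e ▸ h) (fun e => e ▸ h')⟩

instance eqPair [IsVar x] [IsVar y] [IsVar z] :
    Definable (fun _ _ v => x v = ZFSet.pair (y v) (z v)) := by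
  obtain ⟨i, hi⟩ := ‹IsVar x›.out
  obtain ⟨j, hj⟩ := ‹IsVar y›.out
  obtain ⟨k, hk⟩ := ‹IsVar z›.out
  simp only [hi, hj, hk, eq_pair_iff]
  infer_instance

instance pairMem [IsVar x] [IsVar y] [IsVar z] :
    Definable (fun _ _ v => ZFSet.pair (y v) (z v) ∈ x v) := by
  obtain ⟨i, hi⟩ := ‹IsVar x›.out
  obtain ⟨j, hj⟩ := ‹IsVar y›.out
  obtain ⟨k, hk⟩ := ‹IsVar z›.out
  simp only [hi, hj, hk]
  exact (inferInstance : Definable fun _ _ v => ∃ p ∈ v i, p = ZFSet.pair (v j) (v k)).congr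
    fun C B v _ _ => by simp

end Definable

theorem TransClass.of_pair_mem {C : Set ZFSet.{u}} (hC : TransClass C) {p a b : ZFSet.{u}}
    (hp : p ∈ C) (h : ZFSet.pair a b ∈ p) : a ∈ C ∧ b ∈ C := by
  have h1 : ZFSet.pair a b ∈ C := hC _ hp _ h
  have h2 : ({a, b} : ZFSet) ∈ C := hC _ h1 _ (by simp [ZFSet.pair])
  exact ⟨hC _ h2 _ (by simp), hC _ h2 _ (by simp)⟩

namespace Definable

variable {n : ℕ} {x y z : (Fin n → ZFSet.{u}) → ZFSet.{u}}

instance isOrd [IsVar x] : Definable (fun _ _ v => IsOrd (x v)) := by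
  obtain ⟨i, hi⟩ := ‹IsVar x›.out
  simp only [hi, IsOrd, ZFSet.IsTransitive]
  infer_instance

instance isFuncOn [IsVar x] [IsVar y] : Definable (fun _ _ v => IsFuncOn (x v) (y v)) := by
  obtain ⟨i, hi⟩ := ‹IsVar x›.out
  obtain ⟨j, hj⟩ := ‹IsVar y›.out
  refine (inferInstance : Definable fun C _ v =>
    (∀ p ∈ v j, ∃ a ∈ v i, ∃ b ∈ C, p = ZFSet.pair a b) ∧
    ∀ a ∈ v i, ∃ b ∈ C, ZFSet.pair a b ∈ v j ∧ ∀ c ∈ C, ZFSet.pair a c ∈ v j → c = b).congr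
    fun C B v hC hv => ?_
  simp only [hi, hj, IsFuncOn]
  refine and_congr (forall₂_congr fun p hp => ?_) (forall₂_congr fun a ha => ?_)
  · constructor
    · rintro ⟨a, ha, b, hb, h⟩; exact ⟨a, b, ha, h⟩
    · rintro ⟨a, b, ha, h⟩
      exact ⟨a, ha, b, (hC.of_pair_mem (hv j) (h ▸ hp)).2, h⟩
  · constructor
    · rintro ⟨b, _, h, h'⟩
      exact ⟨b, h, fun c hc => h' c (hC.of_pair_mem (hv j) hc).2 hc⟩
    · rintro ⟨b, h, h'⟩
      exact ⟨b, (hC.of_pair_mem (hv j) h).2, h, fun c _ hc => h' c hc⟩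

instance mapsInto [IsVar x] [IsVar y] : Definable (fun _ _ v => MapsInto (x v) (y v)) := by
  obtain ⟨i, hi⟩ := ‹IsVar x›.out
  obtain ⟨j, hj⟩ := ‹IsVar y›.out
  refine (inferInstance : Definable fun C _ v =>
    ∀ a ∈ C, ∀ b ∈ C, ZFSet.pair a b ∈ v i → b ∈ v j).congr fun C B v hC hv => ?_
  simp only [hi, hj, MapsInto]
  exact ⟨fun h a b hab => h a (hC.of_pair_mem (hv i) hab).1 b (hC.of_pair_mem (hv i) hab).2 hab,
    fun h a _ b _ hab => h a b hab⟩

instance injFun [IsVar x] : Definable (fun _ _ v => InjFun (x v)) := by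
  obtain ⟨i, hi⟩ := ‹IsVar x›.out
  refine (inferInstance : Definable fun C _ v => ∀ a ∈ C, ∀ a' ∈ C, ∀ b ∈ C,
    ZFSet.pair a b ∈ v i → ZFSet.pair a' b ∈ v i → a = a').congr fun C B v hC hv => ?_
  simp only [hi, InjFun]
  exact ⟨fun h a a' b hab hab' => h a (hC.of_pair_mem (hv i) hab).1 a'
    (hC.of_pair_mem (hv i) hab').1 b (hC.of_pair_mem (hv i) hab).2 hab hab',
    fun h a _ a' _ b _ hab hab' => h a a' b hab hab'⟩

instance cardLtIn [IsVar x] [IsVar y] : Definable (fun C _ v => CardLtIn C (x v) (y v)) := by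
  obtain ⟨i, hi⟩ := ‹IsVar x›.out
  obtain ⟨j, hj⟩ := ‹IsVar y›.out
  refine (inferInstance : Definable fun C _ v => ∃ b ∈ v j, ∃ f ∈ C,
    IsFuncOn (v i) f ∧ MapsInto f b ∧ InjFun f).congr fun C B v hC hv => ?_
  simp only [hi, hj, CardLtIn]
  exact ⟨fun ⟨b, hb, f, hf, h⟩ => ⟨b, f, hb, hf, h⟩, fun ⟨b, f, hb, hf, h⟩ => ⟨b, hb, f, hf, h⟩⟩

end Definable

/-! ### Transfer along elementary embeddings -/

/-- Interpretation of both unary predicates by `∅`. -/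
def Fml2.toFml : ∀ {n}, Fml2 n → Fml n
  | _, .mem i j => .mem i j
  | _, .eq i j => .eq i j
  | _, .pA i => .mem i i
  | _, .pB i => .mem i i
  | _, .not φ => .not φ.toFml
  | _, .and φ ψ => .and φ.toFml ψ.toFml
  | _, .ex φ => .ex φ.toFml

theorem Fml2.realize_toFml (C : Set ZFSet.{u}) {n : ℕ} (φ : Fml2 n) (v : Fin n → ZFSet.{u}) :
    φ.toFml.Realize C v ↔ φ.Realize C ∅ ∅ v := by
  induction φ <;> simp_all [Fml2.toFml, Fml.Realize, Fml2.Realize, ZFSet.mem_irrefl]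

theorem ElemEmb.transfer {M : Set ZFSet.{u}} (j : ElemEmb Set.univ M) (hM : TransClass M) {n : ℕ}
    (R : Set ZFSet.{u} → Set ZFSet.{u} → (Fin n → ZFSet.{u}) → Prop) [hR : Definable R]
    (v : Fin n → ZFSet.{u}) : R Set.univ ∅ v ↔ R M ∅ (fun i => j.toFun (v i)) := by
  obtain ⟨φ, hφ⟩ := hR.out
  rw [← hφ Set.univ ∅ ∅ v (fun _ _ _ _ => trivial) (fun _ => trivial),
    ← hφ M ∅ ∅ _ hM (fun i => j.maps _ trivial), ← Fml2.realize_toFml, ← Fml2.realize_toFml]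
  exact j.elem _ _ fun _ => trivial

/-! ### Limit ultrapowers of the universe -/

open Filter in
/-- The data of a well-founded limit ultrapower of the universe: a filter together with a class
`Fn` of functions such that the filter decides all events expressible from functions in `Fn`. -/
structure LimUlt (ι : Type (u + 1)) where
  filter : Filter ι
  neBot : filter.NeBot
  Fn : Set (ι → ZFSet.{u})
  comp_mem : ∀ {n : ℕ} (v : Fin n → ι → ZFSet.{u}), (∀ i, v i ∈ Fn) →
    ∀ G : (Fin n → ZFSet.{u}) → ZFSet.{u}, (fun p => G fun i => v i p) ∈ Fn
  decided : ∀ f ∈ Fn, (∀ᶠ p in filter, f p = ∅) ∨ ∀ᶠ p in filter, f p ≠ ∅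
  no_descending : ∀ f : ℕ → ι → ZFSet.{u}, (∀ n, f n ∈ Fn) →
    ¬ ∀ n, ∀ᶠ p in filter, f (n + 1) p ∈ f n p

namespace LimUlt

open Filter

variable {ι : Type (u + 1)} (T : LimUlt ι)

instance : T.filter.NeBot := T.neBot

theorem const_mem (x : ZFSet.{u}) : (fun _ => x) ∈ T.Fn :=
  T.comp_mem (n := 0) (fun i => i.elim0) (fun i => i.elim0) fun _ => x

theorem comp₂_mem {f g : ι → ZFSet.{u}} (hf : f ∈ T.Fn) (hg : g ∈ T.Fn)
    (G : ZFSet.{u} → ZFSet.{u} → ZFSet.{u}) : (fun p => G (f p) (g p)) ∈ T.Fn := by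
  simpa using T.comp_mem ![f, g] (by intro i; fin_cases i <;> simpa) fun w => G (w 0) (w 1)

open Classical in
theorem decided_comp {n : ℕ} (v : Fin n → ι → ZFSet.{u}) (hv : ∀ i, v i ∈ T.Fn)
    (Q : (Fin n → ZFSet.{u}) → Prop) :
    (∀ᶠ p in T.filter, Q fun i => v i p) ∨ ∀ᶠ p in T.filter, ¬ Q fun i => v i p := by
  rcases T.decided _ (T.comp_mem v hv fun w => if Q w then ∅ else {∅}) with h | h
  · left; filter_upwards [h] with p hp
    by_contra hq
    rw [if_neg hq] at hp
    have h0 : (∅ : ZFSet.{u}) ∈ ({∅} : ZFSet.{u}) := by simp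
    rw [hp] at h0
    exact ZFSet.notMem_empty _ h0
  · right; filter_upwards [h] with p hp hq
    simp [hq] at hp

theorem decided₂ {f g : ι → ZFSet.{u}} (hf : f ∈ T.Fn) (hg : g ∈ T.Fn)
    (Q : ZFSet.{u} → ZFSet.{u} → Prop) :
    (∀ᶠ p in T.filter, Q (f p) (g p)) ∨ ∀ᶠ p in T.filter, ¬ Q (f p) (g p) := by
  simpa using T.decided_comp ![f, g] (by intro i; fin_cases i <;> simpa) fun w => Q (w 0) (w 1)

theorem not_eventually_not {Q : ι → Prop} (h : ∀ᶠ p in T.filter, Q p) :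
    ¬ ∀ᶠ p in T.filter, ¬ Q p := fun h' => by
  obtain ⟨p, hp, hp'⟩ := (h.and h').exists
  exact hp' hp

/-- Membership modulo the filter. -/
def E (f g : T.Fn) : Prop := ∀ᶠ p in T.filter, f.1 p ∈ g.1 p

theorem wellFounded_E : WellFounded T.E := by
  rw [wellFounded_iff_isEmpty_descending_chain]
  refine ⟨fun ⟨f, hf⟩ => T.no_descending (fun n => (f n).1) (fun n => (f n).2) hf⟩

open Classical in
/-- Changing `g` on a null set so that it is below `f`. -/
noncomputable def below (g f : T.Fn) : T.Fn :=
  ⟨_, T.comp₂_mem g.2 f.2 fun x y => if x ∈ y then x else ∅⟩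

theorem below_eq {g f : T.Fn} (h : T.E g f) : ∀ᶠ p in T.filter, (T.below g f).1 p = g.1 p := by
  filter_upwards [h] with p hp
  simp [below, hp]

theorem below_mem (g f : T.Fn) (p : ι) : (T.below g f).1 p ∈ insert ∅ (f.1 p) := by
  simp only [below]
  split_ifs with h <;> simp [h]

theorem E.congr_left {T : LimUlt ι} {g g' f : T.Fn} (h : T.E g f)
    (e : ∀ᶠ p in T.filter, g'.1 p = g.1 p) : T.E g' f := by
  filter_upwards [h, e] with p hp hp'
  rwa [hp']

theorem E.congr_right {T : LimUlt ι} {g f' f : T.Fn} (h : T.E g f)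
    (e : ∀ᶠ p in T.filter, f'.1 p = f.1 p) : T.E g f' := by
  filter_upwards [h, e] with p hp hp'
  rwa [hp']

theorem E_below {g f : T.Fn} (h : T.E g f) : T.E (T.below g f) f := h.congr_left (T.below_eq h)

variable [Small.{u} ι]

instance (f : T.Fn) : Small.{u} {g : T.Fn // T.E g f ∧ ∀ p, g.1 p ∈ insert ∅ (f.1 p)} := by
  let F : {g : T.Fn // T.E g f ∧ ∀ p, g.1 p ∈ insert ∅ (f.1 p)} →
    (∀ p : ι, (insert ∅ (f.1 p) : ZFSet.{u})) := fun g p => ⟨g.1.1 p, g.2.2 p⟩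
  refine small_of_injective (f := F) fun g h e => ?_
  ext p : 3
  exact congrArg Subtype.val (congrFun e p)

/-- The transitive collapse of the limit ultrapower. -/
noncomputable def collapse : T.Fn → ZFSet.{u} :=
  T.wellFounded_E.fix fun f ih =>
    ZFSet.range fun g : {g : T.Fn // T.E g f ∧ ∀ p, g.1 p ∈ insert ∅ (f.1 p)} => ih g.1 g.2.1

theorem mem_collapse' {f : T.Fn} {x : ZFSet.{u}} : x ∈ T.collapse f ↔
    ∃ g : T.Fn, (T.E g f ∧ ∀ p, g.1 p ∈ insert ∅ (f.1 p)) ∧ T.collapse g = x := by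
  rw [collapse, WellFounded.fix_eq, ZFSet.mem_range]
  simp

theorem collapse_congr {f f' : T.Fn} (e : ∀ᶠ p in T.filter, f.1 p = f'.1 p) :
    T.collapse f = T.collapse f' := by
  induction f using T.wellFounded_E.induction generalizing f' with
  | _ f ih =>
  ext x
  rw [mem_collapse', mem_collapse']
  constructor
  · rintro ⟨g, ⟨hg, -⟩, rfl⟩
    have hg' : T.E g f' := hg.congr_right (by filter_upwards [e] with p hp using hp.symm)
    exact ⟨T.below g f', ⟨T.E_below hg', T.below_mem _ _⟩,
      (ih g hg (by filter_upwards [T.below_eq hg'] with p hp using hp.symm)).symm⟩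
  · rintro ⟨g, ⟨hg, -⟩, rfl⟩
    have hg' : T.E g f := hg.congr_right e
    exact ⟨T.below g f, ⟨T.E_below hg', T.below_mem _ _⟩, ih _ (T.E_below hg') (T.below_eq hg')⟩

theorem mem_collapse {f : T.Fn} {x : ZFSet.{u}} : x ∈ T.collapse f ↔
    ∃ g : T.Fn, T.E g f ∧ T.collapse g = x := by
  rw [mem_collapse']
  constructor
  · rintro ⟨g, ⟨hg, -⟩, h⟩
    exact ⟨g, hg, h⟩
  · rintro ⟨g, hg, rfl⟩
    exact ⟨T.below g f, ⟨T.E_below hg, T.below_mem _ _⟩, T.collapse_congr (T.below_eq hg)⟩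

open Classical in
theorem eventually_eq_of_collapse_eq {f f' : T.Fn} (e : T.collapse f = T.collapse f') :
    ∀ᶠ p in T.filter, f.1 p = f'.1 p := by
  induction f using T.wellFounded_E.induction generalizing f' with
  | _ f ih =>
  refine (T.decided₂ f.2 f'.2 (· = ·)).resolve_right fun hne => ?_
  have key : ∀ x y : ZFSet.{u}, ∃ z, x ≠ y → ¬ (z ∈ x ↔ z ∈ y) := fun x y => by
    by_cases h : x = y
    · exact ⟨∅, fun h' => (h' h).elim⟩
    · obtain ⟨z, hz⟩ := not_forall.1 fun h' => h (ZFSet.ext h')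
      exact ⟨z, fun _ => hz⟩
  choose G hG using key
  let h : T.Fn := ⟨_, T.comp₂_mem f.2 f'.2 G⟩
  rcases T.decided₂ h.2 f.2 (· ∈ ·) with hf | hf
  · have hmem : T.collapse h ∈ T.collapse f' := e ▸ T.mem_collapse.2 ⟨h, hf, rfl⟩
    obtain ⟨h', hh', eq⟩ := T.mem_collapse.1 hmem
    have := hh'.congr_left (ih h hf eq.symm)
    obtain ⟨p, ⟨hp, hp'⟩, hp''⟩ := ((hf.and this).and hne).exists
    exact hG _ _ hp'' ⟨fun _ => hp', fun _ => hp⟩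
  · have hf' : T.E h f' := by
      filter_upwards [hf, hne] with p hp hp'
      have := hG _ _ hp'
      by_contra hc
      exact this ⟨fun h => (hp h).elim, fun h => (hc h).elim⟩
    have hmem : T.collapse h ∈ T.collapse f := e ▸ T.mem_collapse.2 ⟨h, hf', rfl⟩
    obtain ⟨h', hh', eq⟩ := T.mem_collapse.1 hmem
    have := hh'.congr_left (g' := h) (by filter_upwards [ih h' hh' eq] with p hp using hp.symm)
    exact T.not_eventually_not this hf

theorem collapse_mem_iff {f g : T.Fn} : T.collapse f ∈ T.collapse g ↔ T.E f g := by
  rw [mem_collapse]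
  constructor
  · rintro ⟨h, hh, e⟩
    exact hh.congr_left (T.eventually_eq_of_collapse_eq e.symm)
  · exact fun h => ⟨f, h, rfl⟩

theorem collapse_eq_iff {f g : T.Fn} :
    T.collapse f = T.collapse g ↔ ∀ᶠ p in T.filter, f.1 p = g.1 p :=
  ⟨T.eventually_eq_of_collapse_eq, T.collapse_congr⟩

theorem transClass_range : TransClass (Set.range T.collapse) := by
  rintro _ ⟨f, rfl⟩ y hy
  obtain ⟨g, -, rfl⟩ := T.mem_collapse.1 hy
  exact ⟨g, rfl⟩

/-- Łoś's theorem. -/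
theorem realize_iff {n : ℕ} (φ : Fml n) (v : Fin n → T.Fn) :
    φ.Realize (Set.range T.collapse) (fun i => T.collapse (v i)) ↔
      ∀ᶠ p in T.filter, φ.Realize Set.univ fun i => (v i).1 p := by
  induction φ with
  | mem i j => exact T.collapse_mem_iff
  | eq i j => exact T.collapse_eq_iff
  | not φ ih =>
    simp only [Fml.Realize, ih]
    exact ⟨fun h => (T.decided_comp (fun i => (v i).1) (fun i => (v i).2)
      (φ.Realize Set.univ)).resolve_left h, fun h h' => T.not_eventually_not h' h⟩
  | and φ ψ ih ih' => simp only [Fml.Realize, ih, ih', eventually_and]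
  | @ex n φ ih =>
    have snoc_eq : ∀ g : T.Fn, (fun i => T.collapse ((Fin.snoc v g : Fin (n + 1) → T.Fn) i)) =
        Fin.snoc (fun i => T.collapse (v i)) (T.collapse g) := fun g => by
      funext i
      refine Fin.lastCases ?_ (fun i => ?_) i <;> simp
    have snoc_eq' : ∀ (g : T.Fn) p, (fun i => ((Fin.snoc v g : Fin (n + 1) → T.Fn) i).1 p) =
        Fin.snoc (fun i => (v i).1 p) (g.1 p) := fun g p => by
      funext i
      refine Fin.lastCases ?_ (fun i => ?_) i <;> simp
    simp only [Fml.Realize, Set.exists_range_iff, ← snoc_eq, ih, snoc_eq']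
    constructor
    · rintro ⟨g, hg⟩
      filter_upwards [hg] with p hp
      exact ⟨_, trivial, hp⟩
    · intro h
      have key : ∀ w : Fin n → ZFSet.{u}, ∃ x,
          (∃ x ∈ Set.univ, φ.Realize Set.univ (Fin.snoc w x)) →
          φ.Realize Set.univ (Fin.snoc w x) := fun w => by
        by_cases hw : ∃ x ∈ Set.univ, φ.Realize Set.univ (Fin.snoc w x)
        · obtain ⟨x, -, hx⟩ := hw
          exact ⟨x, fun _ => hx⟩
        · exact ⟨∅, fun h => (hw h).elim⟩
      choose G hG using key
      refine ⟨⟨_, T.comp_mem (fun i => (v i).1) (fun i => (v i).2) G⟩, ?_⟩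
      filter_upwards [h] with p hp
      exact hG _ hp

theorem definable_iff {n : ℕ} (R : Set ZFSet.{u} → Set ZFSet.{u} → (Fin n → ZFSet.{u}) → Prop)
    [hR : Definable R] (v : Fin n → T.Fn) :
    R (Set.range T.collapse) ∅ (fun i => T.collapse (v i)) ↔
      ∀ᶠ p in T.filter, R Set.univ ∅ fun i => (v i).1 p := by
  obtain ⟨φ, hφ⟩ := hR.out
  rw [← hφ _ ∅ ∅ _ T.transClass_range (fun i => ⟨_, rfl⟩), ← Fml2.realize_toFml, T.realize_iff]
  refine eventually_congr (Eventually.of_forall fun p => ?_)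
  rw [Fml2.realize_toFml, hφ Set.univ ∅ ∅ _ (fun _ _ _ _ => trivial) (fun _ => trivial)]

/-- The constant function with value `x`. -/
def const (x : ZFSet.{u}) : T.Fn := ⟨fun _ => x, T.const_mem x⟩

/-- The canonical embedding of the universe into the limit ultrapower. -/
noncomputable def embed : ElemEmb (Set.univ : Set ZFSet.{u}) (Set.range T.collapse) where
  toFun x := T.collapse (T.const x)
  maps x _ := ⟨_, rfl⟩
  elem φ v _ := by rw [T.realize_iff]; simp [const]

end LimUlt

section

/-! ### Functions, cardinality and rank -/

open Cardinal Ordinal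

theorem isOrd_iff {x : ZFSet.{u}} : IsOrd x ↔ x.IsOrdinal :=
  ZFSet.isOrdinal_iff_forall_mem_isTransitive.symm

theorem IsOrd.mem {x y : ZFSet.{u}} (hx : IsOrd x) (hy : y ∈ x) : IsOrd y :=
  isOrd_iff.2 ((isOrd_iff.1 hx).mem hy)

/-- The value of the set-theoretic function `f` at `a`. -/
noncomputable def app (f a : ZFSet.{u}) : ZFSet.{u} := Classical.epsilon fun b => ZFSet.pair a b ∈ f

theorem IsFuncOn.pair_mem_iff {d f : ZFSet.{u}} (h : IsFuncOn d f) {a b : ZFSet.{u}} (ha : a ∈ d) :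
    ZFSet.pair a b ∈ f ↔ b = app f a := by
  obtain ⟨c, hc, hc'⟩ := h.2 a ha
  have : ZFSet.pair a (app f a) ∈ f := Classical.epsilon_spec (p := fun b => ZFSet.pair a b ∈ f) ⟨c, hc⟩
  exact ⟨fun hb => (hc' b hb).trans (hc' _ this).symm, fun e => e ▸ this⟩

theorem IsFuncOn.pair_app {d f : ZFSet.{u}} (h : IsFuncOn d f) {a : ZFSet.{u}} (ha : a ∈ d) :
    ZFSet.pair a (app f a) ∈ f := (h.pair_mem_iff ha).2 rfl

/-- The restriction of `F` to the set `d`, as a set of pairs. -/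
noncomputable def graph (d : ZFSet.{u}) (F : ZFSet.{u} → ZFSet.{u}) : ZFSet.{u} :=
  ZFSet.range fun a : d => ZFSet.pair a.1 (F a.1)

theorem mem_graph {d z : ZFSet.{u}} {F : ZFSet.{u} → ZFSet.{u}} :
    z ∈ graph d F ↔ ∃ a ∈ d, ZFSet.pair a (F a) = z := by
  simp [graph, ZFSet.mem_range]

theorem pair_mem_graph {d a b : ZFSet.{u}} {F : ZFSet.{u} → ZFSet.{u}} :
    ZFSet.pair a b ∈ graph d F ↔ a ∈ d ∧ b = F a := by
  rw [mem_graph]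
  constructor
  · rintro ⟨a', ha', e⟩
    obtain ⟨rfl, rfl⟩ := ZFSet.pair_inj.1 e
    exact ⟨ha', rfl⟩
  · rintro ⟨ha, rfl⟩
    exact ⟨a, ha, rfl⟩

theorem isFuncOn_graph (d : ZFSet.{u}) (F : ZFSet.{u} → ZFSet.{u}) : IsFuncOn d (graph d F) := by
  refine ⟨fun p hp => ?_, fun a ha => ⟨F a, pair_mem_graph.2 ⟨ha, rfl⟩, fun b hb =>
    (pair_mem_graph.1 hb).2⟩⟩
  obtain ⟨a, ha, rfl⟩ := mem_graph.1 hp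
  exact ⟨a, _, ha, rfl⟩

theorem card_le_of_injOn {a b : ZFSet.{u}} (F : ZFSet.{u} → ZFSet.{u}) (hF : ∀ x ∈ a, F x ∈ b)
    (hi : ∀ x ∈ a, ∀ y ∈ a, F x = F y → x = y) : a.card ≤ b.card := by
  rw [← Cardinal.lift_le.{u + 1}, ← ZFSet.cardinalMk_coe_sort, ← ZFSet.cardinalMk_coe_sort]
  exact mk_le_of_injective (f := fun x : a => (⟨F x.1, hF x.1 x.2⟩ : b)) fun x y e =>
    Subtype.ext (hi _ x.2 _ y.2 (congrArg Subtype.val e))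

open Classical in
theorem exists_injOn_of_card_le {a b : ZFSet.{u}} (h : a.card ≤ b.card) :
    ∃ F : ZFSet.{u} → ZFSet.{u}, (∀ x ∈ a, F x ∈ b) ∧ ∀ x ∈ a, ∀ y ∈ a, F x = F y → x = y := by
  rw [← Cardinal.lift_le.{u + 1}, ← ZFSet.cardinalMk_coe_sort, ← ZFSet.cardinalMk_coe_sort, le_def] at h
  obtain ⟨f⟩ := h
  refine ⟨fun x => if hx : x ∈ a then (f ⟨x, hx⟩).1 else ∅, fun x hx => ?_, fun x hx y hy e => ?_⟩
  · simp only [hx, dif_pos]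
    exact (f ⟨x, hx⟩).2
  · simp only [hx, hy, dif_pos] at e
    simpa using f.injective (Subtype.ext e)

theorem card_le_of_injFun {a b f : ZFSet.{u}} (h : IsFuncOn a f) (h' : MapsInto f b)
    (h'' : InjFun f) : a.card ≤ b.card :=
  card_le_of_injOn (app f) (fun _ hx => h' _ _ (h.pair_app hx)) fun x hx y hy e =>
    h'' x y (app f x) (h.pair_app hx) (e ▸ h.pair_app hy)

theorem exists_injFun_of_card_le {a b : ZFSet.{u}} (h : a.card ≤ b.card) :
    ∃ f ⊆ ZFSet.prod a b, IsFuncOn a f ∧ MapsInto f b ∧ InjFun f := by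
  obtain ⟨F, hF, hF'⟩ := exists_injOn_of_card_le h
  refine ⟨graph a F, fun z hz => ?_, isFuncOn_graph a F, fun x y hxy => ?_, fun x x' y h h' => ?_⟩
  · obtain ⟨x, hx, rfl⟩ := mem_graph.1 hz
    exact ZFSet.pair_mem_prod.2 ⟨hx, hF x hx⟩
  · obtain ⟨hx, rfl⟩ := pair_mem_graph.1 hxy
    exact hF x hx
  · obtain ⟨hx, rfl⟩ := pair_mem_graph.1 h
    obtain ⟨hx', e⟩ := pair_mem_graph.1 h'
    exact hF' x hx x' hx' e

theorem setLeIn_univ_iff {a b : ZFSet.{u}} : SetLeIn Set.univ a b ↔ a.card ≤ b.card := by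
  constructor
  · rintro ⟨f, -, h, h', h''⟩
    exact card_le_of_injFun h h' h''
  · intro h
    obtain ⟨f, -, hf⟩ := exists_injFun_of_card_le h
    exact ⟨f, trivial, hf⟩

theorem IsOrd.card_eq {x : ZFSet.{u}} (hx : IsOrd x) : x.card = x.rank.card := by
  conv_lhs => rw [← (isOrd_iff.1 hx).toZFSet_rank_eq]
  exact Ordinal.card_toZFSet _

theorem IsCardIn.card_lt {κ α : ZFSet.{u}} (hκ : IsCard κ) (hα : α ∈ κ) : α.card < κ.card :=
  not_le.1 fun h => hκ.2 α hα (setLeIn_univ_iff.2 h)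

theorem cardLtIn_univ_iff {κ s : ZFSet.{u}} (hκ : IsCard κ) :
    CardLtIn Set.univ s κ ↔ s.card < κ.card := by
  constructor
  · rintro ⟨β, f, hβ, -, h, h', h''⟩
    exact (card_le_of_injFun h h' h'').trans_lt (hκ.card_lt hβ)
  · intro h
    have hβ : s.card.ord.toZFSet ∈ κ := by
      rw [← (isOrd_iff.1 hκ.1).toZFSet_rank_eq, Ordinal.toZFSet_mem_toZFSet_iff]
      by_contra hle
      have := Ordinal.card_le_card (not_lt.1 hle)
      rw [card_ord, ← hκ.1.card_eq] at this
      exact this.not_gt h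
    obtain ⟨f, -, hf⟩ := exists_injFun_of_card_le (a := s) (b := s.card.ord.toZFSet)
      (by rw [Ordinal.card_toZFSet, card_ord])
    exact ⟨_, f, hβ, trivial, hf⟩

/-! ### The class `V_δ` for limit `δ` -/

theorem mem_VBelow {δ x : ZFSet.{u}} : x ∈ VBelow δ ↔ x.rank < δ.rank := Iff.rfl

theorem transClass_VBelow (δ : ZFSet.{u}) : TransClass (VBelow δ) :=
  fun _ hx _ hy => (ZFSet.rank_lt_of_mem hy).trans hx

theorem mem_VBelow_of_subset {δ x y : ZFSet.{u}} (h : x ⊆ y) (hy : y ∈ VBelow δ) : x ∈ VBelow δ :=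
  (ZFSet.rank_mono h).trans_lt hy

theorem IsOrd.mem_of_mem_VBelow {δ x : ZFSet.{u}} (hδ : IsOrd δ) (hx : IsOrd x)
    (h : x ∈ VBelow δ) : x ∈ δ :=
  (ZFSet.IsOrdinal.rank_lt_iff_mem (isOrd_iff.1 hx) (isOrd_iff.1 hδ)).1 h

theorem mem_VBelow_of_mem {δ x : ZFSet.{u}} (h : x ∈ δ) : x ∈ VBelow δ := ZFSet.rank_lt_of_mem h

/-- The class `V_δ` is closed under forming singletons, i.e. `δ` is not a successor. -/
def LimV (δ : ZFSet.{u}) : Prop := ∀ x ∈ VBelow δ, ∃ y ∈ VBelow δ, x ∈ y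

namespace LimV

variable {δ : ZFSet.{u}}

theorem succ_rank_lt (hδ : LimV δ) {x : ZFSet.{u}} (hx : x ∈ VBelow δ) :
    Order.succ x.rank < δ.rank := by
  obtain ⟨y, hy, hxy⟩ := hδ x hx
  exact (Order.succ_le_of_lt (ZFSet.rank_lt_of_mem hxy)).trans_lt hy

theorem insert_mem (hδ : LimV δ) {x y : ZFSet.{u}} (hx : x ∈ VBelow δ) (hy : y ∈ VBelow δ) :
    insert x y ∈ VBelow δ := by
  rw [mem_VBelow, ZFSet.rank_insert]
  exact max_lt (hδ.succ_rank_lt hx) hy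

theorem powerset_mem (hδ : LimV δ) {x : ZFSet.{u}} (hx : x ∈ VBelow δ) :
    x.powerset ∈ VBelow δ := by
  rw [mem_VBelow, ZFSet.rank_powerset]
  exact hδ.succ_rank_lt hx

theorem empty_mem {x : ZFSet.{u}} (hx : x ∈ VBelow δ) : ∅ ∈ VBelow δ :=
  mem_VBelow_of_subset (ZFSet.empty_subset x) hx

theorem pair_mem (hδ : LimV δ) {x y : ZFSet.{u}} (hx : x ∈ VBelow δ) (hy : y ∈ VBelow δ) :
    ZFSet.pair x y ∈ VBelow δ :=
  hδ.insert_mem (hδ.insert_mem hx (empty_mem hx)) (hδ.insert_mem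
    (hδ.insert_mem hx (hδ.insert_mem hy (empty_mem hx))) (empty_mem hx))

theorem union_mem {x y : ZFSet.{u}} (hx : x ∈ VBelow δ) (hy : y ∈ VBelow δ) :
    x ∪ y ∈ VBelow δ := by
  rw [mem_VBelow, ZFSet.rank_union]
  exact max_lt hx hy

theorem prod_mem (hδ : LimV δ) {x y : ZFSet.{u}} (hx : x ∈ VBelow δ) (hy : y ∈ VBelow δ) :
    ZFSet.prod x y ∈ VBelow δ := by
  refine mem_VBelow_of_subset (y := (x ∪ y).powerset.powerset) (fun z hz => ?_)
    (hδ.powerset_mem (hδ.powerset_mem (union_mem hx hy)))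
  obtain ⟨a, ha, b, hb, rfl⟩ := ZFSet.mem_prod.1 hz
  rw [ZFSet.mem_powerset]
  intro c hc
  rw [ZFSet.mem_powerset]
  intro d hd
  rw [ZFSet.mem_union]
  rw [ZFSet.pair, ZFSet.mem_pair] at hc
  rcases hc with rfl | rfl
  · rw [ZFSet.mem_singleton] at hd
    exact Or.inl (hd ▸ ha)
  · rcases ZFSet.mem_pair.1 hd with rfl | rfl
    exacts [Or.inl ha, Or.inr hb]

theorem cardLtIn_iff (hδ : LimV δ) {x κ : ZFSet.{u}} (hx : x ∈ VBelow δ) (hκ : κ ∈ VBelow δ) :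
    CardLtIn (VBelow δ) x κ ↔ CardLtIn Set.univ x κ := by
  constructor
  · rintro ⟨β, f, hβ, -, h⟩
    exact ⟨β, f, hβ, trivial, h⟩
  · rintro ⟨β, f, hβ, -, h, h', h''⟩
    refine ⟨β, f, hβ, mem_VBelow_of_subset (y := ZFSet.prod x β) (fun z hz => ?_)
      (hδ.prod_mem hx (transClass_VBelow δ κ hκ β hβ)), h, h', h''⟩
    obtain ⟨a, b, ha, rfl⟩ := h.1 z hz
    exact ZFSet.pair_mem_prod.2 ⟨ha, h' a b hz⟩

end LimV

/-! ### Finite sets -/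

/-- Finiteness of `t`, in Tarski's sense, relativised to `C`. -/
def FinIn (C : Set ZFSet.{u}) (t : ZFSet.{u}) : Prop :=
  ∀ F ∈ C, (∃ e ∈ F, e = ∅) → (∀ x ∈ F, ∀ a ∈ t, ∀ y ∈ C, y = insert a x → y ∈ F) → t ∈ F

instance {n : ℕ} {x : (Fin n → ZFSet.{u}) → ZFSet.{u}} [IsVar x] :
    Definable (fun C _ v => FinIn C (x v)) := by
  obtain ⟨i, hi⟩ := ‹IsVar x›.out
  simp only [hi, FinIn]
  infer_instance

/-- Being listed by the list `l`. -/
def ListedBy (t : ZFSet.{u}) (l : List ZFSet.{u}) : Prop := ∀ a, a ∈ t ↔ a ∈ l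

theorem LimV.finIn_iff {δ : ZFSet.{u}} (hδ : LimV δ) {t : ZFSet.{u}} (ht : t ∈ VBelow δ) :
    FinIn (VBelow δ) t ↔ ∃ l, ListedBy t l := by
  constructor
  · intro h
    refine (ZFSet.mem_sep.1 (h (ZFSet.sep (fun x => ∃ l, ListedBy x l) t.powerset)
      (mem_VBelow_of_subset (fun z hz => (ZFSet.mem_sep.1 hz).1) (hδ.powerset_mem ht))
      ⟨∅, ?_, rfl⟩ ?_)).2
    · exact ZFSet.mem_sep.2 ⟨by simp, [], fun a => by simp⟩
    · rintro x hx a ha y - rfl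
      obtain ⟨hx, l, hl⟩ := ZFSet.mem_sep.1 hx
      refine ZFSet.mem_sep.2 ⟨?_, a :: l, fun b => by simp [hl b]⟩
      rw [ZFSet.mem_powerset] at hx ⊢
      intro b hb
      rcases ZFSet.mem_insert_iff.1 hb with rfl | hb
      exacts [ha, hx hb]
  · rintro ⟨l, hl⟩ F hF ⟨_, he, rfl⟩ hi
    have key : ∀ l' : List ZFSet.{u}, (∀ a ∈ l', a ∈ t) → ∃ s ∈ F, ListedBy s l' := by
      intro l'
      induction l' with
      | nil => exact fun _ => ⟨∅, he, fun a => by simp⟩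
      | cons b l' ih =>
        intro hb
        obtain ⟨s, hs, hsl⟩ := ih fun a ha => hb a (by simp [ha])
        refine ⟨insert b s, hi s hs b (hb b (by simp)) _ (hδ.insert_mem ?_ ?_) rfl, fun a => ?_⟩
        · exact transClass_VBelow δ t ht b (hb b (by simp))
        · exact transClass_VBelow δ F hF s hs
        · simp [hsl a]
    obtain ⟨s, hs, hsl⟩ := key l fun a => (hl a).2
    rwa [show t = s from ZFSet.ext fun a => (hl a).trans (hsl a).symm]

/-- The set of entries of a list. -/
def ofList : List ZFSet.{u} → ZFSet.{u}
  | [] => ∅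
  | a :: l => insert a (ofList l)

theorem listedBy_ofList (l : List ZFSet.{u}) : ListedBy (ofList l) l := by
  induction l with
  | nil => exact fun a => by simp [ofList]
  | cons b l ih => exact fun a => by simp [ofList, ih a]

theorem ListedBy.eq_ofList {t : ZFSet.{u}} {l : List ZFSet.{u}} (h : ListedBy t l) :
    t = ofList l := ZFSet.ext fun a => (h a).trans (listedBy_ofList l a).symm

theorem ofList_append (l l' : List ZFSet.{u}) : ofList (l ++ l') = ofList l ∪ ofList l' :=
  ZFSet.ext fun a => by
    rw [listedBy_ofList, ZFSet.mem_union, listedBy_ofList, listedBy_ofList, List.mem_append]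

theorem LimV.finIn_ofList {δ : ZFSet.{u}} (hδ : LimV δ) {l : List ZFSet.{u}}
    (hl : ofList l ∈ VBelow δ) : FinIn (VBelow δ) (ofList l) :=
  (hδ.finIn_iff hl).2 ⟨l, listedBy_ofList l⟩

end

section

/-! ### Elementary embeddings of the universe into transitive classes -/

open Cardinal

namespace ElemEmb

variable {M : Set ZFSet.{u}} (j : ElemEmb (Set.univ : Set ZFSet.{u}) M)

theorem mem (x : ZFSet.{u}) : j.toFun x ∈ M := j.maps x trivial

theorem mem_iff (hM : TransClass M) {a b : ZFSet.{u}} : j.toFun a ∈ j.toFun b ↔ a ∈ b := by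
  simpa using (j.transfer hM (n := 2) (fun _ _ v => v 0 ∈ v 1) ![a, b]).symm

theorem inj (hM : TransClass M) {a b : ZFSet.{u}} : j.toFun a = j.toFun b ↔ a = b := by
  simpa using (j.transfer hM (n := 2) (fun _ _ v => v 0 = v 1) ![a, b]).symm

theorem isOrd (hM : TransClass M) {a : ZFSet.{u}} : IsOrd (j.toFun a) ↔ IsOrd a := by
  simpa using (j.transfer hM (n := 1) (fun _ _ v => IsOrd (v 0)) ![a]).symm

theorem map_empty (hM : TransClass M) : j.toFun ∅ = ∅ := by
  simpa using (j.transfer hM (n := 1) (fun _ _ v => v 0 = ∅) ![∅]).1 rfl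

theorem map_insert (hM : TransClass M) (a b : ZFSet.{u}) :
    j.toFun (insert a b) = insert (j.toFun a) (j.toFun b) := by
  simpa using (j.transfer hM (n := 3) (fun _ _ v => v 0 = insert (v 1) (v 2)) ![insert a b, a, b]).1 rfl

theorem map_pair (hM : TransClass M) (a b : ZFSet.{u}) :
    j.toFun (ZFSet.pair a b) = ZFSet.pair (j.toFun a) (j.toFun b) := by
  simpa using (j.transfer hM (n := 3) (fun _ _ v => v 0 = ZFSet.pair (v 1) (v 2))
    ![ZFSet.pair a b, a, b]).1 rfl

theorem map_ofList (hM : TransClass M) (l : List ZFSet.{u}) :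
    j.toFun (ofList l) = ofList (l.map j.toFun) := by
  induction l with
  | nil => exact j.map_empty hM
  | cons a l ih => simp [ofList, j.map_insert hM, ih]

theorem pair_mem (j : ElemEmb (Set.univ : Set ZFSet.{u}) M) (hM : TransClass M) {a b : ZFSet.{u}} (ha : a ∈ M) (hb : b ∈ M) :
    ZFSet.pair a b ∈ M := by
  have := (j.transfer hM (n := 0)
    (fun C _ _ => ∀ a ∈ C, ∀ b ∈ C, ∃ c ∈ C, c = ZFSet.pair a b) ![]).1 (by simp)
  obtain ⟨c, hc, rfl⟩ := this a ha b hb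
  exact hc

theorem inter_mem (j : ElemEmb (Set.univ : Set ZFSet.{u}) M) (hM : TransClass M) {a b : ZFSet.{u}} (ha : a ∈ M) (hb : b ∈ M) :
    a ∩ b ∈ M := by
  have := (j.transfer hM (n := 0) (fun C _ _ => ∀ a ∈ C, ∀ b ∈ C, ∃ c ∈ C,
    (∀ x ∈ c, x ∈ a ∧ x ∈ b) ∧ ∀ x ∈ a, x ∈ b → x ∈ c) ![]).1
    fun a _ b _ => ⟨a ∩ b, trivial, fun x => by simp, fun x => by simp +contextual⟩
  obtain ⟨c, hc, h, h'⟩ := this a ha b hb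
  have e : a ∩ b = c := ZFSet.ext fun x => by
    rw [ZFSet.mem_inter]
    exact ⟨fun hx => h' x hx.1 hx.2, h x⟩
  exact e ▸ hc

end ElemEmb

/-- `w` is the first limit ordinal. -/
def IsOm (w : ZFSet.{u}) : Prop :=
  (∃ e ∈ w, e = ∅) ∧ (∀ x ∈ w, ∃ y ∈ w, y = insert x x) ∧
    ∀ x ∈ w, x = ∅ ∨ ∃ y ∈ w, x = insert y y

theorem IsOm.subset {w w' : ZFSet.{u}} (h : IsOm w) (h0 : ∃ e ∈ w', e = ∅)
    (hs : ∀ x ∈ w', ∃ y ∈ w', y = insert x x) : w ⊆ w' := by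
  intro x
  induction x using ZFSet.inductionOn with
  | _ x ih =>
  intro hx
  rcases h.2.2 x hx with rfl | ⟨y, hy, rfl⟩
  · obtain ⟨_, he, rfl⟩ := h0
    exact he
  · obtain ⟨_, hz, rfl⟩ := hs y (ih y (by simp) hy)
    exact hz

theorem IsOm.unique {w w' : ZFSet.{u}} (h : IsOm w) (h' : IsOm w') : w = w' :=
  ZFSet.ext fun _ => ⟨fun hx => h.subset h'.1 h'.2.1 hx, fun hx => h'.subset h.1 h.2.1 hx⟩

/-- The set of von Neumann natural numbers. -/
noncomputable def om : ZFSet.{u} := (Ordinal.omega0).toZFSet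

theorem isOm_om : IsOm om.{u} := by
  simp only [IsOm, om, Ordinal.mem_toZFSet_iff, Ordinal.lt_omega0]
  refine ⟨⟨∅, ⟨0, ⟨0, by simp⟩, by simp⟩, rfl⟩, ?_, ?_⟩
  · rintro _ ⟨_, ⟨n, rfl⟩, rfl⟩
    exact ⟨_, ⟨n + 1, ⟨n + 1, by simp⟩, rfl⟩, Ordinal.toZFSet_add_one _⟩
  · rintro _ ⟨_, ⟨n, rfl⟩, rfl⟩
    cases n with
    | zero => simp
    | succ n => exact Or.inr ⟨_, ⟨n, ⟨n, rfl⟩, rfl⟩, by simp [Ordinal.toZFSet_add_one]⟩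

theorem isOrd_om : IsOrd om.{u} := isOrd_iff.2 (ZFSet.isOrdinal_toZFSet _)

theorem card_om : om.{u}.card = ℵ₀ := by simp [om]

section Crit

variable {M : Set ZFSet.{u}} {j : ElemEmb (Set.univ : Set ZFSet.{u}) M} {κ : ZFSet.{u}}

theorem ElemEmb.map_om (j : ElemEmb (Set.univ : Set ZFSet.{u}) M) (hM : TransClass M) : j.toFun om = om := by
  refine IsOm.unique ?_ isOm_om
  have := (j.transfer hM (n := 1) (fun _ _ v => (∃ e ∈ v 0, e = ∅) ∧ (∀ x ∈ v 0, ∃ y ∈ v 0, y = insert x x) ∧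
    ∀ x ∈ v 0, x = ∅ ∨ ∃ y ∈ v 0, x = insert y y) ![om]).1 isOm_om
  exact this

theorem IsCrit.mem_map (h : IsCrit j κ) (hM : TransClass M) : κ ∈ j.toFun κ := by
  rcases (isOrd_iff.1 h.1).mem_trichotomous (isOrd_iff.1 ((j.isOrd hM).2 h.1)) with h' | h' | h'
  · exact h'
  · exact (h.2.1 h'.symm).elim
  · have := (j.mem_iff hM).2 h'
    rw [h.2.2 _ h'] at this
    exact (ZFSet.mem_irrefl _ this).elim

theorem IsCrit.om_mem (h : IsCrit j κ) (hM : TransClass M) : om ∈ κ := by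
  rcases (isOrd_iff.1 h.1).mem_trichotomous (isOrd_iff.1 isOrd_om) with h' | rfl | h'
  · exfalso
    have key : ∀ n : ℕ, j.toFun (n : Ordinal).toZFSet = (n : Ordinal).toZFSet := fun n => by
      induction n with
      | zero => simpa using j.map_empty hM
      | succ n ih => simp [Ordinal.toZFSet_add_one, j.map_insert hM, ih]
    rw [om, Ordinal.mem_toZFSet_iff] at h'
    obtain ⟨a, ha, rfl⟩ := h'
    obtain ⟨n, rfl⟩ := Ordinal.lt_omega0.1 ha
    exact h.2.1 (key n)
  · exact (h.2.1 (j.map_om hM)).elim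
  · exact h'

theorem IsCrit.isCard (h : IsCrit j κ) (hM : TransClass M) : IsCard κ := by
  refine ⟨h.1, ?_⟩
  rintro α hα ⟨f, -, hf, hf', hf''⟩
  have h1 : IsFuncOn (j.toFun κ) (j.toFun f) := by
    simpa using (j.transfer hM (n := 2) (fun _ _ v => IsFuncOn (v 0) (v 1)) ![κ, f]).1 hf
  have h2 : MapsInto (j.toFun f) (j.toFun α) := by
    simpa using (j.transfer hM (n := 2) (fun _ _ v => MapsInto (v 0) (v 1)) ![f, α]).1 hf'
  have h3 : InjFun (j.toFun f) := by
    simpa using (j.transfer hM (n := 1) (fun _ _ v => InjFun (v 0)) ![f]).1 hf''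
  have hp := h1.pair_app (h.mem_map hM)
  have hx : app (j.toFun f) κ ∈ α := h.2.2 α hα ▸ h2 _ _ hp
  set x := app (j.toFun f) κ
  have hjx : j.toFun x = x := h.2.2 x (h.1.1.subset_of_mem hα hx)
  obtain ⟨y, hy, hyx⟩ : ∃ y ∈ κ, ZFSet.pair y x ∈ f := by
    refine (j.transfer hM (n := 3) (fun _ _ v => ∃ y ∈ v 0, ZFSet.pair y (v 1) ∈ v 2) ![κ, x, f]).2 ?_
    exact ⟨κ, h.mem_map hM, by simpa [hjx] using hp⟩
  have : ZFSet.pair y x ∈ j.toFun f := by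
    simpa [j.map_pair hM, hjx, h.2.2 y hy] using (j.mem_iff hM).2 hyx
  have e := h3 _ _ _ this hp
  exact ZFSet.mem_irrefl _ (e ▸ hy)

theorem IsCrit.aleph0_lt (h : IsCrit j κ) (hM : TransClass M) : ℵ₀ < κ.card :=
  card_om.symm.trans_lt ((h.isCard hM).card_lt (h.om_mem hM))

end Crit

theorem limV_of_isCard {δ : ZFSet.{u}} (hδ : IsCard δ) (h : om ∈ δ) : LimV δ := by
  intro x hx
  refine ⟨{x}, ?_, by simp⟩
  rw [mem_VBelow, ZFSet.rank_singleton]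
  refine lt_of_le_of_ne (Order.succ_le_of_lt hx) fun e => ?_
  have hmem : x.rank.toZFSet ∈ δ := by
    rw [← (isOrd_iff.1 hδ.1).toZFSet_rank_eq, Ordinal.toZFSet_mem_toZFSet_iff]
    exact hx
  have h1 := hδ.card_lt hmem
  have h2 := hδ.card_lt h
  rw [card_om] at h2
  rw [hδ.1.card_eq, ← e] at h1 h2
  rw [Ordinal.card_toZFSet, Order.succ_eq_add_one, Ordinal.card_add_one] at h1
  rw [Order.succ_eq_add_one, Ordinal.card_add_one] at h2
  have h3 : ℵ₀ ≤ x.rank.card := by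
    by_contra hc
    exact h2.not_gt (Cardinal.add_lt_aleph0 (not_le.1 hc) Cardinal.one_lt_aleph0)
  rw [Cardinal.add_one_eq h3] at h1
  exact h1.false

end

/-! ### First-order description of strong compactness embeddings -/

/-- The partial functions `p` and `q` agree on `t`. -/
def AgreeOn (C : Set ZFSet.{u}) (t p q : ZFSet.{u}) : Prop :=
  ∀ ξ ∈ t, ∀ y ∈ C, (ZFSet.pair ξ y ∈ p ↔ ZFSet.pair ξ y ∈ q)

instance {n : ℕ} {t p q : (Fin n → ZFSet.{u}) → ZFSet.{u}} [IsVar t] [IsVar p] [IsVar q] :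
    Definable (fun C _ v => AgreeOn C (t v) (p v) (q v)) := by
  obtain ⟨i, hi⟩ := ‹IsVar t›.out
  obtain ⟨j, hj⟩ := ‹IsVar p›.out
  obtain ⟨k, hk⟩ := ‹IsVar q›.out
  simp only [hi, hj, hk, AgreeOn]
  infer_instance

/-- The data of `Wit`: a set `I` of functions on `L` and a family `U` of subsets of `I`. -/
def WitBase (κ lam I U L st : ZFSet.{u}) : Prop :=
  (∀ p ∈ I, IsFuncOn L p) ∧ (∀ x ∈ L, x ∈ lam ∨ x = lam ∨ x = st) ∧ lam ⊆ L ∧ lam ∈ L ∧ st ∈ L ∧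
  (∃ X ∈ U, X ⊆ I) ∧ (∀ X ∈ U, X ⊆ I ∧ ¬ X = ∅) ∧ (∀ X ∈ U, ∀ Y ∈ U, ∃ Z ∈ U, Z ⊆ X ∧ Z ⊆ Y) ∧
  (∀ α ∈ κ, ∃ X ∈ U, ∀ p ∈ X, ZFSet.pair α α ∈ p)

/-- `U` decides all subsets of `I` with finite support. -/
def WitDecided (C : Set ZFSet.{u}) (I U L : ZFSet.{u}) : Prop :=
  ∀ t ∈ C, t ⊆ L → FinIn C t → ∀ X ∈ C, X ⊆ I →
    (∀ p ∈ I, ∀ q ∈ I, AgreeOn C t p q → p ∈ X → q ∈ X) →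
    X ∈ U ∨ ∃ Y ∈ U, ∀ p ∈ Y, ¬ p ∈ X

/-- The limit ultrapower is well-founded. -/
def WitWf (C : Set ZFSet.{u}) (I U L : ZFSet.{u}) : Prop :=
  ∀ N ∈ C, ∀ R ∈ C, (∀ Y ∈ C, ¬ Y = ∅ → ∃ y ∈ Y, ∀ z ∈ Y, ¬ ZFSet.pair z y ∈ R) → ¬ N = ∅ →
    ¬ ∀ n ∈ N,
      (∃ t ∈ C, t ⊆ L ∧ FinIn C t ∧ ∀ p ∈ I, ∀ q ∈ I, AgreeOn C t p q →
        ∀ z ∈ C, ∀ a ∈ C, ∀ b ∈ C, a = ZFSet.pair n p → b = ZFSet.pair n q →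
          ZFSet.pair z a ∈ R → ZFSet.pair z b ∈ R) ∧
      ∃ m ∈ N, ∃ X ∈ U, ∀ p ∈ X, ∃ a ∈ C, ∃ b ∈ C,
        a = ZFSet.pair m p ∧ b = ZFSet.pair n p ∧ ZFSet.pair a b ∈ R

/-- The `ξ`-th projection represents `ξ`, for `ξ ≤ lam`. -/
def WitProj (C : Set ZFSet.{u}) (lam I U L : ZFSet.{u}) : Prop :=
  ∀ ξ ∈ C, ξ ∈ lam ∨ ξ = lam →
    (∀ η ∈ ξ, ∃ X ∈ U, ∀ p ∈ X, ∃ y ∈ C, ∃ z ∈ C,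
      ZFSet.pair η y ∈ p ∧ ZFSet.pair ξ z ∈ p ∧ y ∈ z) ∧
    ∀ f ∈ C, IsFuncOn I f →
      (∃ t ∈ C, t ⊆ L ∧ FinIn C t ∧ ∀ p ∈ I, ∀ q ∈ I, AgreeOn C t p q →
        ∀ y ∈ C, ZFSet.pair p y ∈ f → ZFSet.pair q y ∈ f) →
      (∃ X ∈ U, ∀ p ∈ X, ∃ y ∈ C, ∃ z ∈ C, ZFSet.pair p y ∈ f ∧ ZFSet.pair ξ z ∈ p ∧ y ∈ z) →
      ∃ η ∈ ξ, ∃ X ∈ U, ∀ p ∈ X, ∃ y ∈ C, ZFSet.pair p y ∈ f ∧ ZFSet.pair η y ∈ p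

/-- The remaining properties of the projections. -/
def WitCover (C B : Set ZFSet.{u}) (κ lam U st : ZFSet.{u}) : Prop :=
  (∀ ξ ∈ lam, ξ ∈ B → ∃ X ∈ U, ∀ p ∈ X, ∃ y ∈ C, ZFSet.pair ξ y ∈ p ∧ y ∈ B) ∧
  (∀ ξ ∈ lam, ¬ ξ ∈ B → ∃ X ∈ U, ∀ p ∈ X, ∃ y ∈ C, ZFSet.pair ξ y ∈ p ∧ ¬ y ∈ B) ∧
  (∃ X ∈ U, ∀ p ∈ X, ∃ y ∈ C, ZFSet.pair lam y ∈ p ∧ y ∈ κ) ∧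
  (∀ α ∈ lam, ∃ X ∈ U, ∀ p ∈ X, ∃ y ∈ C, ZFSet.pair st y ∈ p ∧ α ∈ y) ∧
  (∃ X ∈ U, ∀ p ∈ X, ∃ y ∈ C, ZFSet.pair st y ∈ p ∧ CardLtIn C y κ)

/-- `I`, `U`, `L`, `st` code an embedding witnessing that `κ` is `lam`-strongly compact for
the class `B`. -/
def Wit (C B : Set ZFSet.{u}) (κ lam I U L st : ZFSet.{u}) : Prop :=
  WitBase κ lam I U L st ∧ WitDecided C I U L ∧ WitWf C I U L ∧ WitProj C lam I U L ∧
    WitCover C B κ lam U st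

/-- The first-order part of the `Π¹₁` definition of being Woodin for strong compactness. -/
def WoodinBody (C B : Set ZFSet.{u}) : Prop :=
  (∀ x ∈ C, ∃ y ∈ C, x ∈ y) ∧
  (∃ w ∈ C, (∃ e ∈ w, e = ∅) ∧ ∀ x ∈ w, ∃ y ∈ w, y = insert x x) ∧
  (∀ β ∈ C, IsOrd β → ¬ ((∀ x ∈ C, IsOrd x → ∃ y ∈ β, ∃ z ∈ C, z = ZFSet.pair x y ∧ z ∈ B) ∧
    ∀ x ∈ C, ∀ x' ∈ C, ∀ y ∈ C, ∀ z ∈ C, ∀ z' ∈ C, z = ZFSet.pair x y → z' = ZFSet.pair x' y →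
      z ∈ B → z' ∈ B → x = x')) ∧
  ∃ κ ∈ C, IsOrd κ ∧ ∀ lam ∈ C, IsOrd lam → κ ∈ lam ∨ κ = lam →
    ∃ I ∈ C, ∃ U ∈ C, ∃ L ∈ C, ∃ st ∈ C, Wit C B κ lam I U L st

set_option maxHeartbeats 1000000 in
set_option synthInstance.maxHeartbeats 1000000 in
set_option synthInstance.maxSize 2000 in
instance definable_woodinBody : Definable (n := 0) (fun C B _ => WoodinBody.{u} C B) := by
  unfold WoodinBody Wit WitBase WitDecided WitWf WitProj WitCover
  infer_instance

/-! ### From codes to embeddings -/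

/-- The functions on `I` depending only on finitely many values of their argument. -/
def FinSupp (I L : ZFSet.{u}) : Set ({p // p ∈ I} → ZFSet.{u}) :=
  {f | ∃ l : List ZFSet.{u}, (∀ ξ ∈ l, ξ ∈ L) ∧
    ∀ p q : {p // p ∈ I}, (∀ ξ ∈ l, app p.1 ξ = app q.1 ξ) → f p = f q}

/-- A code, in `V_δ`, for an embedding. -/
structure IsCode (δ : ZFSet.{u}) (B : Set ZFSet.{u}) (κ lam I U L st : ZFSet.{u}) : Prop where
  lim : LimV δ
  om_mem : om ∈ VBelow δ
  mem_I : I ∈ VBelow δ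
  mem_L : L ∈ VBelow δ
  wit : Wit (VBelow δ) B κ lam I U L st

theorem toZFSet_nat_inj {m n : ℕ} : (m : Ordinal.{u}).toZFSet = (n : Ordinal.{u}).toZFSet ↔ m = n := by
  rw [Ordinal.toZFSet_injective.eq_iff, Nat.cast_inj]

theorem natCast_mem_om (n : ℕ) : (n : Ordinal.{u}).toZFSet ∈ om := by
  rw [om, Ordinal.toZFSet_mem_toZFSet_iff]
  exact Ordinal.natCast_lt_omega0 n

namespace IsCode

variable {δ : ZFSet.{u}} {B : Set ZFSet.{u}} {κ lam I U L st : ZFSet.{u}}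

theorem func (h : IsCode δ B κ lam I U L st) {p : ZFSet.{u}} (hp : p ∈ I) : IsFuncOn L p :=
  h.wit.1.1 p hp

theorem app_mem (h : IsCode δ B κ lam I U L st) {p ξ : ZFSet.{u}} (hp : p ∈ I) (hξ : ξ ∈ L) :
    app p ξ ∈ VBelow δ :=
  ((transClass_VBelow δ).of_pair_mem (transClass_VBelow δ _ h.mem_I p hp)
    ((h.func hp).pair_app hξ)).2

theorem ofList_mem (h : IsCode δ B κ lam I U L st) {l : List ZFSet.{u}} (hl : ∀ ξ ∈ l, ξ ∈ L) :
    ofList l ⊆ L ∧ ofList l ∈ VBelow δ ∧ FinIn (VBelow δ) (ofList l) := by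
  have h1 : ofList l ⊆ L := fun a ha => hl a ((listedBy_ofList l a).1 ha)
  have h2 := mem_VBelow_of_subset h1 h.mem_L
  exact ⟨h1, h2, h.lim.finIn_ofList h2⟩

theorem app_eq_of_agreeOn (h : IsCode δ B κ lam I U L st) {l : List ZFSet.{u}}
    (hl : ∀ ξ ∈ l, ξ ∈ L) {p q : ZFSet.{u}} (hp : p ∈ I) (hq : q ∈ I)
    (hpq : AgreeOn (VBelow δ) (ofList l) p q) : ∀ ξ ∈ l, app p ξ = app q ξ := fun ξ hξ =>
  ((h.func hq).pair_mem_iff (hl ξ hξ)).1 ((hpq ξ ((listedBy_ofList l ξ).2 hξ) _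
    (h.app_mem hp (hl ξ hξ))).1 ((h.func hp).pair_app (hl ξ hξ)))

/-- The filter generated by `U`. -/
def filter (h : IsCode δ B κ lam I U L st) : Filter {p // p ∈ I} where
  sets := {s | ∃ X ∈ U, ∀ p : {p // p ∈ I}, p.1 ∈ X → p ∈ s}
  univ_sets := by
    obtain ⟨X, hX, -⟩ := h.wit.1.2.2.2.2.2.1
    exact ⟨X, hX, fun _ _ => trivial⟩
  sets_of_superset := by
    rintro s t ⟨X, hX, hs⟩ hst
    exact ⟨X, hX, fun p hp => hst (hs p hp)⟩
  inter_sets := by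
    rintro s t ⟨X, hX, hs⟩ ⟨Y, hY, ht⟩
    obtain ⟨Z, hZ, hZX, hZY⟩ := h.wit.1.2.2.2.2.2.2.2.1 X hX Y hY
    exact ⟨Z, hZ, fun p hp => ⟨hs p (hZX hp), ht p (hZY hp)⟩⟩

theorem eventually_iff (h : IsCode δ B κ lam I U L st) {P : {p // p ∈ I} → Prop} :
    (∀ᶠ p in h.filter, P p) ↔ ∃ X ∈ U, ∀ p : {p // p ∈ I}, p.1 ∈ X → P p := Iff.rfl

theorem mem_I_of_mem (h : IsCode δ B κ lam I U L st) {X p : ZFSet.{u}} (hX : X ∈ U) (hp : p ∈ X) :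
    p ∈ I := (h.wit.1.2.2.2.2.2.2.1 X hX).1 hp

theorem exists_iff (h : IsCode δ B κ lam I U L st) {P : ZFSet.{u} → Prop} :
    (∃ X ∈ U, ∀ p ∈ X, P p) ↔ ∀ᶠ p in h.filter, P p.1 :=
  ⟨fun ⟨X, hX, hP⟩ => ⟨X, hX, fun p hp => hP p.1 hp⟩,
    fun ⟨X, hX, hP⟩ => ⟨X, hX, fun p hp => hP ⟨p, h.mem_I_of_mem hX hp⟩ hp⟩⟩

theorem finSupp_decided (h : IsCode δ B κ lam I U L st) (f : {p // p ∈ I} → ZFSet.{u})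
    (hf : f ∈ FinSupp I L) :
    (∀ᶠ p in h.filter, f p = ∅) ∨ ∀ᶠ p in h.filter, f p ≠ ∅ := by
  obtain ⟨l, hl, hf⟩ := hf
  obtain ⟨h1, h2, h3⟩ := h.ofList_mem hl
  have hsub : ZFSet.sep (fun p => ∀ hp : p ∈ I, f ⟨p, hp⟩ = ∅) I ⊆ I :=
    fun p hp => (ZFSet.mem_sep.1 hp).1
  refine (h.wit.2.1 _ h2 h1 h3 _ (mem_VBelow_of_subset hsub h.mem_I) hsub ?_).imp (fun h4 => ?_) ?_
  · intro p hp q hq hpq hpX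
    refine ZFSet.mem_sep.2 ⟨hq, fun _ => ?_⟩
    rw [← hf ⟨p, hp⟩ ⟨q, hq⟩ (h.app_eq_of_agreeOn hl hp hq hpq)]
    exact (ZFSet.mem_sep.1 hpX).2 hp
  · exact ⟨_, h4, fun p hp => (ZFSet.mem_sep.1 hp).2 p.2⟩
  · rintro ⟨Y, hY, h4⟩
    exact ⟨Y, hY, fun p hp e => h4 p.1 hp (ZFSet.mem_sep.2 ⟨p.2, fun _ => e⟩)⟩

open Classical in
theorem no_descending (h : IsCode δ B κ lam I U L st) (f : ℕ → {p // p ∈ I} → ZFSet.{u})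
    (hf : ∀ n, f n ∈ FinSupp I L) : ¬ ∀ n, ∀ᶠ p in h.filter, f (n + 1) p ∈ f n p := by
  intro hd
  let nz : ℕ → ZFSet.{u} := fun n => (n : Ordinal.{u}).toZFSet
  let val : ZFSet.{u} → ZFSet.{u} := fun w =>
    if hw : ∃ x : ℕ × {p // p ∈ I}, w = ZFSet.pair (nz x.1) x.2.1 then
      f hw.choose.1 hw.choose.2 else ∅
  have val_pair : ∀ n (p : {p // p ∈ I}), val (ZFSet.pair (nz n) p.1) = f n p := by
    intro n p
    have hw : ∃ x : ℕ × {p // p ∈ I}, ZFSet.pair (nz n) p.1 = ZFSet.pair (nz x.1) x.2.1 :=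
      ⟨(n, p), rfl⟩
    have e := hw.choose_spec
    rw [ZFSet.pair_inj, toZFSet_nat_inj] at e
    simp only [val, dif_pos hw, ← e.1, Subtype.ext e.2.symm]
  let Q := ZFSet.prod om I
  have hQ : Q ∈ VBelow δ := h.lim.prod_mem h.om_mem h.mem_I
  have mem_Q : ∀ n (p : {p // p ∈ I}), ZFSet.pair (nz n) p.1 ∈ Q := fun n p =>
    ZFSet.pair_mem_prod.2 ⟨natCast_mem_om n, p.2⟩
  let R := ZFSet.sep (fun w => ∃ a b, w = ZFSet.pair a b ∧ val a ∈ val b) (ZFSet.prod Q Q)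
  have mem_R : ∀ a b, ZFSet.pair a b ∈ R ↔ (a ∈ Q ∧ b ∈ Q) ∧ val a ∈ val b := by
    intro a b
    simp only [R, ZFSet.mem_sep, ZFSet.pair_mem_prod, ZFSet.pair_inj]
    refine and_congr_right fun _ => ⟨?_, fun h => ⟨a, b, ⟨rfl, rfl⟩, h⟩⟩
    rintro ⟨_, _, ⟨rfl, rfl⟩, h⟩
    exact h
  have hR : R ∈ VBelow δ :=
    mem_VBelow_of_subset (fun z hz => (ZFSet.mem_sep.1 hz).1) (h.lim.prod_mem hQ hQ)
  refine h.wit.2.2.1 om h.om_mem R hR ?_ ?_ ?_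
  · intro Y _ hY
    obtain ⟨y, hy, hmin⟩ := (InvImage.wf val ZFSet.mem_wf).has_min {y | y ∈ Y}
      (by
        by_contra hne
        exact hY ((ZFSet.eq_empty Y).2 fun y hy => hne ⟨y, hy⟩))
    exact ⟨y, hy, fun z hz hzy => hmin z hz ((mem_R z y).1 hzy).2⟩
  · intro e
    exact ZFSet.notMem_empty _ (e ▸ natCast_mem_om 0)
  · intro n hn
    obtain ⟨k, rfl⟩ : ∃ k : ℕ, n = nz k := by
      rw [om, Ordinal.mem_toZFSet_iff] at hn
      obtain ⟨a, ha, rfl⟩ := hn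
      obtain ⟨k, rfl⟩ := Ordinal.lt_omega0.1 ha
      exact ⟨k, rfl⟩
    obtain ⟨l, hl, hs⟩ := hf k
    obtain ⟨h1, h2, h3⟩ := h.ofList_mem hl
    refine ⟨⟨ofList l, h2, h1, h3, ?_⟩, nz (k + 1), natCast_mem_om _, ?_⟩
    · rintro p hp q hq hpq z - a - b - rfl rfl hza
      rw [mem_R] at hza ⊢
      refine ⟨⟨hza.1.1, mem_Q k ⟨q, hq⟩⟩, ?_⟩
      rw [val_pair k ⟨q, hq⟩, ← hs ⟨p, hp⟩ ⟨q, hq⟩ (h.app_eq_of_agreeOn hl hp hq hpq),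
        ← val_pair]
      exact hza.2
    · obtain ⟨X, hX, hXd⟩ := hd k
      refine ⟨X, hX, fun p hp => ?_⟩
      have hpI := h.mem_I_of_mem hX hp
      refine ⟨_, transClass_VBelow δ _ hQ _ (mem_Q (k + 1) ⟨p, hpI⟩), _,
        transClass_VBelow δ _ hQ _ (mem_Q k ⟨p, hpI⟩), rfl, rfl,
        (mem_R _ _).2 ⟨⟨mem_Q _ ⟨p, hpI⟩, mem_Q _ ⟨p, hpI⟩⟩, ?_⟩⟩
      rw [val_pair (k + 1) ⟨p, hpI⟩, val_pair k ⟨p, hpI⟩]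
      exact hXd ⟨p, hpI⟩ hp

/-- The limit ultrapower given by a code. -/
def ult (h : IsCode δ B κ lam I U L st) : LimUlt {p // p ∈ I} where
  filter := h.filter
  neBot := by
    refine Filter.neBot_iff.2 fun e => ?_
    obtain ⟨X, hX, hF⟩ := h.eventually_iff.1 (show ∀ᶠ p in h.filter, False by rw [e]; trivial)
    obtain ⟨hXI, hXne⟩ := h.wit.1.2.2.2.2.2.2.1 X hX
    exact hXne ((ZFSet.eq_empty X).2 fun p hp => hF ⟨p, hXI hp⟩ hp)
  Fn := FinSupp I L
  comp_mem {n} v hv G := by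
    choose l hl hs using hv
    refine ⟨(List.ofFn l).flatten, ?_, ?_⟩
    · intro ξ hξ
      simp only [List.mem_flatten, List.mem_ofFn] at hξ
      obtain ⟨_, ⟨i, rfl⟩, hξ⟩ := hξ
      exact hl i ξ hξ
    · intro p q hpq
      have : (fun i => v i p) = fun i => v i q := funext fun i => hs i p q fun ξ hξ =>
        hpq ξ (by
          simp only [List.mem_flatten, List.mem_ofFn]
          exact ⟨_, ⟨i, rfl⟩, hξ⟩)
      exact congrArg G this
  decided := h.finSupp_decided
  no_descending := h.no_descending

/-- The `ξ`-th projection. -/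
noncomputable def proj (h : IsCode δ B κ lam I U L st) {ξ : ZFSet.{u}} (hξ : ξ ∈ L) : h.ult.Fn :=
  ⟨fun p => app p.1 ξ, [ξ], by simpa using hξ, fun p q hpq => hpq ξ (by simp)⟩

theorem mem_L_of_le (h : IsCode δ B κ lam I U L st) {ξ : ZFSet.{u}} (hξ : ξ ∈ lam ∨ ξ = lam) :
    ξ ∈ L := by
  rcases hξ with hξ | rfl
  · exact h.wit.1.2.2.1 hξ
  · exact h.wit.1.2.2.2.1

theorem lam_mem (h : IsCode δ B κ lam I U L st) : lam ∈ L := h.mem_L_of_le (.inr rfl)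

theorem st_mem (h : IsCode δ B κ lam I U L st) : st ∈ L := h.wit.1.2.2.2.2.1

theorem exists_app_iff (h : IsCode δ B κ lam I U L st) {ξ : ZFSet.{u}} (hξ : ξ ∈ L)
    {P : ZFSet.{u} → Prop} : (∃ X ∈ U, ∀ p ∈ X, ∃ y ∈ VBelow δ, ZFSet.pair ξ y ∈ p ∧ P y) ↔
      ∀ᶠ p in h.ult.filter, P ((h.proj hξ).1 p) := by
  rw [h.exists_iff]
  refine Filter.eventually_congr (.of_forall fun p => ?_)
  simp only [(h.func p.2).pair_mem_iff hξ]
  exact ⟨by rintro ⟨_, _, rfl, h⟩; exact h, fun hP => ⟨_, h.app_mem p.2 hξ, rfl, hP⟩⟩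

end IsCode

namespace IsCode

variable {δ : ZFSet.{u}} {B : Set ZFSet.{u}} {κ lam I U L st : ZFSet.{u}}

theorem sUnion_mem_VBelow {x : ZFSet.{u}} (hx : x ∈ VBelow δ) : ZFSet.sUnion x ∈ VBelow δ :=
  (ZFSet.rank_sUnion_le x).trans_lt hx

theorem exists_graph (h : IsCode δ B κ lam I U L st) {ξ : ZFSet.{u}} (hξ : ξ ∈ L) (g : h.ult.Fn)
    (hg : ∀ p, g.1 p ∈ insert ∅ ((h.proj hξ).1 p)) :
    ∃ f ∈ VBelow δ, IsFuncOn I f ∧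
      ∀ (p : {p // p ∈ I}) (y : ZFSet.{u}), ZFSet.pair p.1 y ∈ f ↔ y = g.1 p := by
  classical
  let F : ZFSet.{u} → ZFSet.{u} := fun p => if hp : p ∈ I then g.1 ⟨p, hp⟩ else ∅
  have hF : ∀ p : {p // p ∈ I}, F p.1 = g.1 p := fun p => dif_pos p.2
  refine ⟨graph I F, ?_, isFuncOn_graph I F, fun p y => ?_⟩
  · refine mem_VBelow_of_subset
      (y := ZFSet.prod I (insert ∅ (ZFSet.sUnion (ZFSet.sUnion (ZFSet.sUnion (ZFSet.sUnion I))))))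
      (fun z hz => ?_) (h.lim.prod_mem h.mem_I (h.lim.insert_mem (LimV.empty_mem h.mem_I)
        (sUnion_mem_VBelow (sUnion_mem_VBelow (sUnion_mem_VBelow (sUnion_mem_VBelow h.mem_I))))))
    obtain ⟨p, hp, rfl⟩ := mem_graph.1 hz
    refine ZFSet.pair_mem_prod.2 ⟨hp, ?_⟩
    rw [hF ⟨p, hp⟩]
    refine ZFSet.mem_insert_iff.2 ((ZFSet.mem_insert_iff.1 (hg ⟨p, hp⟩)).imp_right fun hy => ?_)
    refine ZFSet.mem_sUnion_of_mem hy (ZFSet.mem_sUnion_of_mem (z := {ξ, app p ξ})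
      (by simp [proj]) (ZFSet.mem_sUnion_of_mem (z := ZFSet.pair ξ (app p ξ))
      (by simp [ZFSet.pair]) (ZFSet.mem_sUnion_of_mem ((h.func hp).pair_app hξ) hp)))
  · rw [pair_mem_graph, hF p]
    exact and_iff_right p.2

theorem collapse_proj (h : IsCode δ B κ lam I U L st) (hlam : IsOrd lam) {ξ : ZFSet.{u}}
    (hξ : ξ ∈ lam ∨ ξ = lam) : h.ult.collapse (h.proj (h.mem_L_of_le hξ)) = ξ := by
  induction ξ using ZFSet.inductionOn with
  | _ ξ ih =>
  have hξC : ξ ∈ VBelow δ := transClass_VBelow δ _ h.mem_L _ (h.mem_L_of_le hξ)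
  have hlt : ∀ {η}, η ∈ ξ → η ∈ lam := fun hη => by
    rcases hξ with hξ | rfl
    · exact hlam.1.subset_of_mem hξ hη
    · exact hη
  obtain ⟨h1, h2⟩ := h.wit.2.2.2.1 ξ hξC hξ
  ext x
  rw [h.ult.mem_collapse]
  constructor
  · rintro ⟨g, hg, rfl⟩
    obtain ⟨f, hf, hfun, hpair⟩ := h.exists_graph (h.mem_L_of_le hξ)
      (h.ult.below g (h.proj (h.mem_L_of_le hξ))) (h.ult.below_mem _ _)
    obtain ⟨l, hl, hs⟩ := (h.ult.below g (h.proj (h.mem_L_of_le hξ))).2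
    obtain ⟨hl1, hl2, hl3⟩ := h.ofList_mem hl
    have hsupp : ∀ p ∈ I, ∀ q ∈ I, AgreeOn (VBelow δ) (ofList l) p q → ∀ y ∈ VBelow δ,
        ZFSet.pair p y ∈ f → ZFSet.pair q y ∈ f := fun p hp q hq hpq y _ hpy => by
      rw [hpair ⟨p, hp⟩] at hpy
      rw [hpair ⟨q, hq⟩, hpy, hs ⟨p, hp⟩ ⟨q, hq⟩ (h.app_eq_of_agreeOn hl hp hq hpq)]
    have hval : ∀ᶠ p in h.ult.filter, ∃ y ∈ VBelow δ, ∃ z ∈ VBelow δ,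
        ZFSet.pair p.1 y ∈ f ∧ ZFSet.pair ξ z ∈ p.1 ∧ y ∈ z := by
      filter_upwards [h.ult.E_below hg] with p hp
      have hz := h.app_mem p.2 (h.mem_L_of_le hξ)
      exact ⟨_, transClass_VBelow δ _ hz _ hp, _, hz, (hpair p _).2 rfl,
        (h.func p.2).pair_app (h.mem_L_of_le hξ), hp⟩
    obtain ⟨η, hη, hev⟩ := h2 f hf hfun ⟨ofList l, hl2, hl1, hl3, hsupp⟩ (h.exists_iff.2 hval)
    have hη' : η ∈ lam ∨ η = lam := .inl (hlt hη)
    suffices e : h.ult.collapse g = h.ult.collapse (h.proj (h.mem_L_of_le hη')) by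
      rwa [e, ih η hη hη']
    refine h.ult.collapse_congr ?_
    filter_upwards [h.ult.below_eq hg, h.exists_iff.1 hev] with p hp ⟨y, _, hy, hy'⟩
    rw [hpair p] at hy
    rw [← hp, ← hy]
    exact ((h.func p.2).pair_mem_iff (h.mem_L_of_le hη')).1 hy'
  · intro hx
    refine ⟨_, ?_, ih x hx (.inl (hlt hx))⟩
    filter_upwards [h.exists_iff.1 (h1 x hx)] with p ⟨y, _, z, _, hy, hz, hyz⟩
    rw [(h.func p.2).pair_mem_iff (h.mem_L_of_le (.inl (hlt hx)))] at hy
    rw [(h.func p.2).pair_mem_iff (h.mem_L_of_le hξ)] at hz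
    subst hy hz
    exact hyz

end IsCode

section

section Hull

open Cardinal

variable {I : ZFSet.{u}} (X : ZFSet.{u}) (H : ZFSet.{u} → ZFSet.{u})
  (f : ZFSet.{u} → {p // p ∈ I} → ZFSet.{u}) (l : ZFSet.{u} → List ZFSet.{u})

/-- The values of the functions `f x`, for `H x ∈ b`, at arguments whose values on `l x` lie
in `R`. -/
noncomputable def hullSet (b R : ZFSet.{u}) : ZFSet.{u} :=
  ZFSet.range fun q : {q : {x // x ∈ X} × {p // p ∈ I} //
    H q.1.1 ∈ b ∧ ∀ ξ ∈ l q.1.1, app q.2.1 ξ ∈ R} => f q.1.1.1 q.1.2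

variable {X H f l}

theorem mem_hullSet {b R y : ZFSet.{u}} : y ∈ hullSet X H f l b R ↔
    ∃ x ∈ X, H x ∈ b ∧ ∃ p : {p // p ∈ I}, (∀ ξ ∈ l x, app p.1 ξ ∈ R) ∧ f x p = y := by
  rw [hullSet, ZFSet.mem_range]
  constructor
  · rintro ⟨⟨⟨x, p⟩, h, h'⟩, rfl⟩
    exact ⟨x.1, x.2, h, p, h', rfl⟩
  · rintro ⟨x, hx, h, p, h', rfl⟩
    exact ⟨⟨⟨⟨x, hx⟩, p⟩, h, h'⟩, rfl⟩

theorem card_hullSet_lt (hH : ∀ x ∈ X, ∀ y ∈ X, H x = H y → x = y)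
    (hf : ∀ x, ∀ p q : {p // p ∈ I}, (∀ ξ ∈ l x, app p.1 ξ = app q.1 ξ) → f x p = f x q)
    {b R : ZFSet.{u}} {c : Cardinal.{u}} (hc : ℵ₀ < c) (hb : b.card < c) (hR : R.card < c) :
    (hullSet X H f l b R).card < c := by
  have key : #(hullSet X H f l b R) ≤ #(b × List R) := by
    choose x hx hxb p hp hy using fun y : hullSet X H f l b R => mem_hullSet.1 y.2
    have hm : ∀ y, ∀ a ∈ (l (x y)).map (app (p y).1), a ∈ R := fun y a ha => by
      obtain ⟨ξ, hξ, rfl⟩ := List.mem_map.1 ha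
      exact hp y ξ hξ
    refine mk_le_of_injective (f := fun y => ((⟨H (x y), hxb y⟩ : b),
      ((l (x y)).map (app (p y).1)).attachWith (· ∈ R) (hm y))) fun y z e => ?_
    rw [Prod.mk.injEq, Subtype.mk.injEq] at e
    have e1 := hH _ (hx y) _ (hx z) e.1
    have e2 := congrArg (List.map Subtype.val) e.2
    rw [List.attachWith_map_subtype_val, List.attachWith_map_subtype_val, ← e1,
      List.map_inj_left] at e2
    refine Subtype.ext ?_
    rw [← hy y, ← hy z, ← e1]
    exact hf _ _ _ e2
  rw [mk_prod, lift_id, lift_id] at key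
  rw [← Cardinal.lift_lt.{u, u + 1}, ← ZFSet.cardinalMk_coe_sort]
  have hc' : ℵ₀ < lift.{u + 1} c := by simpa using hc
  refine key.trans_lt (mul_lt_of_lt hc'.le ?_ ((mk_list_le_max _).trans_lt (max_lt hc' ?_)))
  · rwa [ZFSet.cardinalMk_coe_sort, Cardinal.lift_lt]
  · rwa [ZFSet.cardinalMk_coe_sort, Cardinal.lift_lt]

end Hull

namespace IsCode

variable {δ : ZFSet.{u}} {B : Set ZFSet.{u}} {κ lam I U L st : ZFSet.{u}}

theorem isCrit (h : IsCode δ B κ lam I U L st) (hlam : IsOrd lam) (hκ : IsOrd κ)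
    (hle : oLe κ lam) : IsCrit h.ult.embed κ ∧ lam ∈ h.ult.embed.toFun κ := by
  have hmem : lam ∈ h.ult.embed.toFun κ := by
    have : h.ult.collapse (h.proj (h.mem_L_of_le (.inr rfl))) ∈ h.ult.collapse (h.ult.const κ) :=
      h.ult.collapse_mem_iff.2 ((h.exists_app_iff h.lam_mem).1 h.wit.2.2.2.2.2.2.1)
    rwa [h.collapse_proj hlam (.inr rfl)] at this
  have hsub : ∀ {α}, α ∈ κ → α ∈ lam := fun {α} hα => by
    rcases hle with hle | rfl
    · exact hlam.1.subset_of_mem hle hα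
    · exact hα
  refine ⟨⟨hκ, fun e => ?_, fun α hα => ?_⟩, hmem⟩
  · rw [e] at hmem
    exact ZFSet.mem_irrefl _ (hsub hmem)
  · have hα' : α ∈ lam ∨ α = lam := .inl (hsub hα)
    conv_rhs => rw [← h.collapse_proj hlam hα']
    refine h.ult.collapse_congr ?_
    filter_upwards [h.exists_iff.1 (h.wit.1.2.2.2.2.2.2.2.2 α hα)] with p hp
    exact ((h.func p.2).pair_mem_iff (h.mem_L_of_le hα')).1 hp

theorem agreeMem (h : IsCode δ B κ lam I U L st) (hlam : IsOrd lam) {A : ZFSet.{u}}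
    (hA : ∀ x, x ∈ A ↔ x ∈ B) : AgreeMem lam A (h.ult.embed.toFun A) := by
  intro ξ hξ
  have hξ' : ξ ∈ lam ∨ ξ = lam := .inl hξ
  have key : ξ ∈ h.ult.embed.toFun A ↔
      ∀ᶠ p in h.ult.filter, (h.proj (h.mem_L_of_le hξ')).1 p ∈ A := by
    conv_lhs => rw [← h.collapse_proj hlam hξ']
    exact h.ult.collapse_mem_iff
  rw [key]
  simp only [hA]
  constructor
  · intro hB
    exact (h.exists_app_iff _).1 (h.wit.2.2.2.2.1 ξ hξ hB)
  · intro hB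
    by_contra hn
    exact h.ult.not_eventually_not hB
      ((h.exists_app_iff _).1 (h.wit.2.2.2.2.2.1 ξ hξ hn))

theorem eventually_app_mem (h : IsCode δ B κ lam I U L st) (hlam : IsOrd lam) {ξ : ZFSet.{u}}
    (hξ : ξ ∈ L) : ∀ᶠ p in h.ult.filter,
      app p.1 ξ ∈ insert (app p.1 st) (insert (app p.1 lam) (app p.1 lam)) := by
  rcases h.wit.1.2.1 ξ hξ with hξ' | rfl | rfl
  · have : h.ult.collapse (h.proj (h.mem_L_of_le (.inl hξ'))) ∈
        h.ult.collapse (h.proj (h.mem_L_of_le (.inr rfl))) := by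
      rwa [h.collapse_proj hlam (.inl hξ'), h.collapse_proj hlam (.inr rfl)]
    filter_upwards [h.ult.collapse_mem_iff.1 this] with p hp
    exact ZFSet.mem_insert_iff.2 (.inr (ZFSet.mem_insert_iff.2 (.inr hp)))
  · exact .of_forall fun p => by simp
  · exact .of_forall fun p => by simp

open Cardinal in
theorem coversIn (h : IsCode δ B κ lam I U L st) (hlam : IsOrd lam) (hκ : IsCard κ)
    (hκ' : ℵ₀ < κ.card) (hκδ : κ ∈ VBelow δ) :
    CoversIn Set.univ (Set.range h.ult.collapse) h.ult.embed.toFun κ lam := by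
  intro X _ hXM hXlam
  obtain ⟨H, hH, hHi⟩ := exists_injOn_of_card_le (setLeIn_univ_iff.1 hXlam)
  have hex : ∀ x, ∃ f : h.ult.Fn, x ∈ X → h.ult.collapse f = x := fun x => by
    by_cases hx : x ∈ X
    · obtain ⟨f, hf⟩ := hXM hx
      exact ⟨f, fun _ => hf⟩
    · exact ⟨h.ult.const ∅, fun hx' => (hx hx').elim⟩
  choose f hf using hex
  choose l hl hs using fun x => (f x).2
  let g : h.ult.Fn := ⟨_, h.ult.comp₂_mem (h.proj h.lam_mem).2 (h.proj h.st_mem).2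
    fun a b => hullSet X H (fun x => (f x).1) l b (insert b (insert a a))⟩
  refine ⟨h.ult.collapse g, ⟨g, rfl⟩, fun x hx => ?_, ?_⟩
  · rw [← hf x hx, h.ult.collapse_mem_iff]
    filter_upwards [(h.exists_app_iff h.st_mem).1 (h.wit.2.2.2.2.2.2.2.1 _ (hH x hx)),
      (Filter.eventually_all_finite (l x).finite_toSet).2 fun ξ hξ =>
        h.eventually_app_mem hlam (hl x ξ hξ)] with p hp hp'
    exact mem_hullSet (f := fun x => (f x).1).2 ⟨x, hx, hp, p, hp', rfl⟩
  · have := (h.ult.definable_iff (n := 2) (fun C _ v => CardLtIn C (v 0) (v 1))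
      ![g, h.ult.const κ]).2 ?_
    · exact this
    filter_upwards [(h.exists_app_iff h.lam_mem).1 h.wit.2.2.2.2.2.2.1,
      (h.exists_app_iff h.st_mem).1 h.wit.2.2.2.2.2.2.2.2] with p hp hp'
    have hb : (app p.1 st).card < κ.card :=
      (cardLtIn_univ_iff hκ).1 ((h.lim.cardLtIn_iff (h.app_mem p.2 h.st_mem) hκδ).1 hp')
    refine (cardLtIn_univ_iff hκ).2 (card_hullSet_lt hHi hs hκ' hb ?_)
    have h1 : (1 : Cardinal.{u}) < κ.card := one_lt_aleph0.trans hκ'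
    refine ZFSet.card_insert_le.trans_lt (add_lt_of_lt hκ'.le ?_ h1)
    exact ZFSet.card_insert_le.trans_lt (add_lt_of_lt hκ'.le (hκ.card_lt hp) h1)

theorem lamSCFor (h : IsCode δ B κ lam I U L st) (hlam : IsOrd lam) (hκ : IsOrd κ)
    (hle : oLe κ lam) (hκδ : κ ∈ VBelow δ) {A : ZFSet.{u}} (hA : ∀ x, x ∈ A ↔ x ∈ B) :
    LamSCFor κ lam A := by
  have hM := h.ult.transClass_range
  obtain ⟨hc, hm⟩ := h.isCrit hlam hκ hle
  exact ⟨_, Set.subset_univ _, hM, h.ult.embed, hc, hm,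
    h.coversIn hlam (hc.isCard hM) (hc.aleph0_lt hM) hκδ, h.agreeMem hlam hA⟩

end IsCode

end

/-! ### Coding embeddings by seeds -/

/-- The set of functions from `L` to `D`. -/
noncomputable def funcs (L D : ZFSet.{u}) : ZFSet.{u} :=
  ZFSet.sep (fun p => IsFuncOn L p ∧ MapsInto p D) (ZFSet.prod L D).powerset

theorem mem_funcs {L D p : ZFSet.{u}} : p ∈ funcs L D ↔ IsFuncOn L p ∧ MapsInto p D := by
  rw [funcs, ZFSet.mem_sep, ZFSet.mem_powerset, and_iff_right_iff_imp]
  rintro ⟨h, h'⟩ z hz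
  obtain ⟨a, b, ha, rfl⟩ := h.1 z hz
  exact ZFSet.pair_mem_prod.2 ⟨ha, h' a b hz⟩

theorem LimV.funcs_mem {δ : ZFSet.{u}} (hδ : LimV δ) {L D : ZFSet.{u}} (hL : L ∈ VBelow δ)
    (hD : D ∈ VBelow δ) : funcs L D ∈ VBelow δ :=
  mem_VBelow_of_subset (fun _ hz => (ZFSet.mem_sep.1 hz).1)
    (hδ.powerset_mem (hδ.prod_mem hL hD))

theorem graph_mem_funcs {L D : ZFSet.{u}} {F : ZFSet.{u} → ZFSet.{u}} (hF : ∀ a ∈ L, F a ∈ D) :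
    graph L F ∈ funcs L D := by
  refine mem_funcs.2 ⟨isFuncOn_graph L F, fun a b hab => ?_⟩
  obtain ⟨ha, rfl⟩ := pair_mem_graph.1 hab
  exact hF a ha

theorem exists_update {L D p : ZFSet.{u}} (hp : p ∈ funcs L D) {a b : ZFSet.{u}} (hb : b ∈ D) :
    ∃ q ∈ funcs L D, (a ∈ L → ZFSet.pair a b ∈ q) ∧
      ∀ c ∈ L, ∀ y ∈ D, ¬ c = a → ZFSet.pair c y ∈ p → ZFSet.pair c y ∈ q := by
  classical
  obtain ⟨h1, h2⟩ := mem_funcs.1 hp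
  refine ⟨graph L fun c => if c = a then b else app p c, graph_mem_funcs fun c hc => ?_,
    fun ha => ?_, fun c hc y _ hca hcy => ?_⟩
  · split_ifs
    · exact hb
    · exact h2 _ _ (h1.pair_app hc)
  · simp [pair_mem_graph, ha]
  · simpa [pair_mem_graph, hc, hca] using (h1.pair_mem_iff hc).1 hcy

theorem agreeOn_iff_univ {C : Set ZFSet.{u}} (hC : TransClass C) {t p q : ZFSet.{u}} (hp : p ∈ C)
    (hq : q ∈ C) : AgreeOn C t p q ↔ AgreeOn Set.univ t p q :=
  ⟨fun h ξ hξ y _ => ⟨fun hy => (h ξ hξ y (hC.of_pair_mem hp hy).2).1 hy,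
    fun hy => (h ξ hξ y (hC.of_pair_mem hq hy).2).2 hy⟩, fun h ξ hξ y _ => h ξ hξ y trivial⟩

theorem AgreeOn.mono {C : Set ZFSet.{u}} {t t' p q : ZFSet.{u}} (h : AgreeOn C t' p q)
    (ht : t ⊆ t') : AgreeOn C t p q := fun ξ hξ => h ξ (ht hξ)

theorem AgreeOn.symm {C : Set ZFSet.{u}} {t p q : ZFSet.{u}} (h : AgreeOn C t p q) :
    AgreeOn C t q p := fun ξ hξ y hy => (h ξ hξ y hy).symm

/-- `S` assigns to each element of `L` a seed in `j D`. -/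
structure Seeds {M : Set ZFSet.{u}} (j : ElemEmb (Set.univ : Set ZFSet.{u}) M) (L D : ZFSet.{u})
    (S : ZFSet.{u} → ZFSet.{u}) : Prop where
  trans : TransClass M
  nonempty : ∅ ∈ D
  seed_mem : ∀ ξ ∈ L, S ξ ∈ j.toFun D

/-- `p` takes the value `S ξ` at `j ξ`, for `ξ ∈ l`. -/
def Fits {M : Set ZFSet.{u}} (j : ElemEmb (Set.univ : Set ZFSet.{u}) M)
    (S : ZFSet.{u} → ZFSet.{u}) (l : List ZFSet.{u}) (p : ZFSet.{u}) : Prop :=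
  ∀ ξ ∈ l, ZFSet.pair (j.toFun ξ) (S ξ) ∈ p

/-- Whether `p ∈ I` belongs to `X` depends only on the values of `p` on `l`. -/
def SuppBy (I : ZFSet.{u}) (l : List ZFSet.{u}) (X : ZFSet.{u}) : Prop :=
  ∀ p ∈ I, ∀ q ∈ I, AgreeOn Set.univ (ofList l) p q → p ∈ X → q ∈ X

/-- The family of sets derived from the seeds `S`. -/
noncomputable def seedFamily {M : Set ZFSet.{u}} (j : ElemEmb (Set.univ : Set ZFSet.{u}) M)
    (L D : ZFSet.{u}) (S : ZFSet.{u} → ZFSet.{u}) : ZFSet.{u} :=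
  ZFSet.sep (fun X => ∃ l : List ZFSet.{u}, (∀ ξ ∈ l, ξ ∈ L) ∧ SuppBy (funcs L D) l X ∧
    ∃ p ∈ j.toFun X, Fits j S l p) (funcs L D).powerset

theorem mem_seedFamily {M : Set ZFSet.{u}} {j : ElemEmb (Set.univ : Set ZFSet.{u}) M}
    {L D : ZFSet.{u}} {S : ZFSet.{u} → ZFSet.{u}} {X : ZFSet.{u}} : X ∈ seedFamily j L D S ↔
      X ⊆ funcs L D ∧ ∃ l : List ZFSet.{u}, (∀ ξ ∈ l, ξ ∈ L) ∧ SuppBy (funcs L D) l X ∧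
        ∃ p ∈ j.toFun X, Fits j S l p := by
  rw [seedFamily, ZFSet.mem_sep, ZFSet.mem_powerset]

theorem fits_append {M : Set ZFSet.{u}} {j : ElemEmb (Set.univ : Set ZFSet.{u}) M}
    {S : ZFSet.{u} → ZFSet.{u}} {l l' : List ZFSet.{u}} {p : ZFSet.{u}} :
    Fits j S (l ++ l') p ↔ Fits j S l p ∧ Fits j S l' p := by
  simp only [Fits, List.mem_append]
  exact ⟨fun h => ⟨fun ξ hξ => h ξ (.inl hξ), fun ξ hξ => h ξ (.inr hξ)⟩,
    fun h ξ hξ => hξ.elim (h.1 ξ) (h.2 ξ)⟩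

theorem fits_cons {M : Set ZFSet.{u}} {j : ElemEmb (Set.univ : Set ZFSet.{u}) M}
    {S : ZFSet.{u} → ZFSet.{u}} {ξ : ZFSet.{u}} {l : List ZFSet.{u}} {p : ZFSet.{u}} :
    Fits j S (ξ :: l) p ↔ ZFSet.pair (j.toFun ξ) (S ξ) ∈ p ∧ Fits j S l p := by
  simp [Fits]

namespace Seeds

variable {M : Set ZFSet.{u}} {j : ElemEmb (Set.univ : Set ZFSet.{u}) M} {L D : ZFSet.{u}}
  {S : ZFSet.{u} → ZFSet.{u}}

theorem mem_map_funcs (h : Seeds j L D S) {p : ZFSet.{u}} (hp : p ∈ j.toFun (funcs L D)) :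
    IsFuncOn (j.toFun L) p ∧ MapsInto p (j.toFun D) :=
  (j.transfer h.trans (n := 3) (fun _ _ v => ∀ p ∈ v 0, IsFuncOn (v 1) p ∧ MapsInto p (v 2))
    ![funcs L D, L, D]).1 (fun _ hp => mem_funcs.1 hp) p hp

theorem exists_fits (h : Seeds j L D S) {l : List ZFSet.{u}} (hl : ∀ ξ ∈ l, ξ ∈ L) :
    ∃ p ∈ j.toFun (funcs L D), Fits j S l p := by
  induction l with
  | nil =>
    obtain ⟨p, hp, -⟩ := (j.transfer h.trans (n := 1) (fun _ _ v => ∃ p ∈ v 0, p = p)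
      ![funcs L D]).1 ⟨_, graph_mem_funcs (F := fun _ => ∅) fun _ _ => h.nonempty, rfl⟩
    exact ⟨p, hp, fun ξ hξ => by simp at hξ⟩
  | cons ξ l ih =>
    obtain ⟨p, hp, hpl⟩ := ih fun η hη => hl η (by simp [hη])
    obtain ⟨q, hq, hq1, hq2⟩ := (j.transfer h.trans (n := 3) (fun _ _ v =>
      ∀ p ∈ v 0, ∀ a ∈ v 1, ∀ b ∈ v 2, ∃ q ∈ v 0, (a ∈ v 1 → ZFSet.pair a b ∈ q) ∧
        ∀ c ∈ v 1, ∀ y ∈ v 2, ¬ c = a → ZFSet.pair c y ∈ p → ZFSet.pair c y ∈ q)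
      ![funcs L D, L, D]).1 (fun p hp a _ b hb => exists_update hp hb)
      p hp _ ((j.mem_iff h.trans).2 (hl ξ (by simp))) _ (h.seed_mem ξ (hl ξ (by simp)))
    have h1 := hq1 ((j.mem_iff h.trans).2 (hl ξ (by simp)))
    refine ⟨q, hq, fits_cons.2 ⟨h1, fun η hη => ?_⟩⟩
    by_cases e : η = ξ
    · exact e ▸ h1
    · exact hq2 _ ((j.mem_iff h.trans).2 (hl η (by simp [hη]))) _ (h.seed_mem η (hl η (by simp [hη])))
        (fun e' => e ((j.inj h.trans).1 e')) (hpl η hη)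

theorem eq_seed (h : Seeds j L D S) {p : ZFSet.{u}} (hp : p ∈ j.toFun (funcs L D))
    {ξ y : ZFSet.{u}} (hξ : ξ ∈ L) (hs : ZFSet.pair (j.toFun ξ) (S ξ) ∈ p)
    (hy : ZFSet.pair (j.toFun ξ) y ∈ p) : y = S ξ := by
  have hf := (h.mem_map_funcs hp).1
  have := (j.mem_iff h.trans).2 hξ
  exact ((hf.pair_mem_iff this).1 hy).trans ((hf.pair_mem_iff this).1 hs).symm

theorem agreeOn_of_fits (h : Seeds j L D S) {l : List ZFSet.{u}} (hl : ∀ ξ ∈ l, ξ ∈ L)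
    {p q : ZFSet.{u}} (hp : p ∈ j.toFun (funcs L D)) (hq : q ∈ j.toFun (funcs L D))
    (hpl : Fits j S l p) (hql : Fits j S l q) : AgreeOn M (j.toFun (ofList l)) p q := by
  intro ξ hξ y _
  rw [j.map_ofList h.trans, listedBy_ofList, List.mem_map] at hξ
  obtain ⟨ξ, hξ, rfl⟩ := hξ
  constructor
  · intro hy
    rw [h.eq_seed hp (hl ξ hξ) (hpl ξ hξ) hy]
    exact hql ξ hξ
  · intro hy
    rw [h.eq_seed hq (hl ξ hξ) (hql ξ hξ) hy]
    exact hpl ξ hξ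

theorem mem_map_of_fits (h : Seeds j L D S) {l : List ZFSet.{u}} (hl : ∀ ξ ∈ l, ξ ∈ L)
    {X p q : ZFSet.{u}} (hX : X ⊆ funcs L D) (hs : SuppBy (funcs L D) l X) (hp : p ∈ j.toFun X)
    (hpl : Fits j S l p) (hq : q ∈ j.toFun (funcs L D)) (hql : Fits j S l q) : q ∈ j.toFun X := by
  have hp' : p ∈ j.toFun (funcs L D) :=
    (j.transfer h.trans (n := 2) (fun _ _ v => v 0 ⊆ v 1) ![X, funcs L D]).1 hX hp
  exact (j.transfer h.trans (n := 3) (fun C _ v => ∀ p ∈ v 0, ∀ q ∈ v 0, AgreeOn C (v 1) p q →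
    p ∈ v 2 → q ∈ v 2) ![funcs L D, ofList l, X]).1 hs p hp' q hq
      (h.agreeOn_of_fits hl hp' hq hpl hql) hp

/-- Membership in the family of sets derived from the seeds, using any support. -/
theorem mem_seedFamily_of_fits (h : Seeds j L D S) {l : List ZFSet.{u}} (hl : ∀ ξ ∈ l, ξ ∈ L)
    {X : ZFSet.{u}} (hX : X ⊆ funcs L D) (hs : SuppBy (funcs L D) l X)
    (hj : ∀ p ∈ j.toFun (funcs L D), Fits j S l p → p ∈ j.toFun X) : X ∈ seedFamily j L D S := by
  obtain ⟨p, hp, hpl⟩ := h.exists_fits hl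
  exact mem_seedFamily.2 ⟨hX, l, hl, hs, p, hj p hp hpl, hpl⟩

/-- A set in the family contains all points fitting its support. -/
theorem exists_support (h : Seeds j L D S) {X : ZFSet.{u}} (hX : X ∈ seedFamily j L D S) :
    ∃ l : List ZFSet.{u}, (∀ ξ ∈ l, ξ ∈ L) ∧ SuppBy (funcs L D) l X ∧
      ∀ p ∈ j.toFun (funcs L D), Fits j S l p → p ∈ j.toFun X := by
  obtain ⟨hX, l, hl, hs, p, hp, hpl⟩ := mem_seedFamily.1 hX
  exact ⟨l, hl, hs, fun q hq hql => h.mem_map_of_fits hl hX hs hp hpl hq hql⟩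

/-- A relation between two seeds in the sense of `M` holds almost everywhere. -/
theorem eventually_pair (h : Seeds j L D S) {ξ η W : ZFSet.{u}} (hξ : ξ ∈ L) (hη : η ∈ L)
    (hW : ZFSet.pair (S ξ) (S η) ∈ j.toFun W) : ∃ X ∈ seedFamily j L D S, ∀ p ∈ X,
      ZFSet.pair (app p ξ) (app p η) ∈ W := by
  set X := ZFSet.sep (fun p => ZFSet.pair (app p ξ) (app p η) ∈ W) (funcs L D) with hXdef
  have hX : X ⊆ funcs L D := fun p hp => (ZFSet.mem_sep.1 hp).1
  refine ⟨X, h.mem_seedFamily_of_fits (l := [ξ, η]) (by simp [hξ, hη]) hX ?_ ?_,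
    fun p hp => (ZFSet.mem_sep.1 hp).2⟩
  · intro p hp q hq hpq hpX
    refine ZFSet.mem_sep.2 ⟨hq, ?_⟩
    have key : ∀ ζ ∈ [ξ, η], ζ ∈ L → app q ζ = app p ζ := fun ζ hζ hζL =>
      ((mem_funcs.1 hp).1.pair_mem_iff hζL).1 ((hpq ζ ((listedBy_ofList _ _).2 hζ) _ trivial).2
        ((mem_funcs.1 hq).1.pair_app hζL))
    rw [key ξ (by simp) hξ, key η (by simp) hη]
    exact (ZFSet.mem_sep.1 hpX).2
  · intro p hp hpl
    have key : ∀ p ∈ funcs L D, ∀ y ∈ D, ∀ z ∈ D, ZFSet.pair ξ y ∈ p → ZFSet.pair η z ∈ p →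
        ZFSet.pair y z ∈ W → p ∈ X := by
      intro p hp y _ z _ hy hz hyz
      refine ZFSet.mem_sep.2 ⟨hp, ?_⟩
      rw [← ((mem_funcs.1 hp).1.pair_mem_iff hξ).1 hy, ← ((mem_funcs.1 hp).1.pair_mem_iff hη).1 hz]
      exact hyz
    exact (j.transfer h.trans (n := 6) (fun _ _ v => ∀ p ∈ v 0, ∀ y ∈ v 1, ∀ z ∈ v 1,
      ZFSet.pair (v 2) y ∈ p → ZFSet.pair (v 3) z ∈ p → ZFSet.pair y z ∈ v 4 → p ∈ v 5)
      ![funcs L D, D, ξ, η, W, X]).1 key p hp _ (h.seed_mem ξ hξ) _ (h.seed_mem η hη)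
      (hpl ξ (by simp)) (hpl η (by simp)) hW

theorem eventually_mem (h : Seeds j L D S) {ξ W : ZFSet.{u}} (hξ : ξ ∈ L)
    (hW : S ξ ∈ j.toFun W) : ∃ X ∈ seedFamily j L D S, ∀ p ∈ X, app p ξ ∈ W := by
  obtain ⟨X, hX, hXW⟩ := h.eventually_pair (W := ZFSet.prod W W) hξ hξ
    ((j.transfer h.trans (n := 2) (fun _ _ v => ∀ a ∈ v 0, ZFSet.pair a a ∈ v 1)
      ![W, ZFSet.prod W W]).1 (fun a ha => ZFSet.pair_mem_prod.2 ⟨ha, ha⟩) _ hW)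
  exact ⟨X, hX, fun p hp => (ZFSet.pair_mem_prod.1 (hXW p hp)).1⟩

end Seeds

/-- A ranking function for a well-founded relation on a set. -/
theorem exists_rankFun {Q R : ZFSet.{u}}
    (hwf : ∀ Y ⊆ Q, ¬ Y = ∅ → ∃ y ∈ Y, ∀ z ∈ Y, ¬ ZFSet.pair z y ∈ R) :
    ∃ ρ : ZFSet.{u} → ZFSet.{u}, ∀ y w, w ∈ ρ y ↔
      ∃ z ∈ Q, (y ∈ Q ∧ ZFSet.pair z y ∈ R) ∧ w = ρ z := by
  classical
  have wf : WellFounded fun z y : ZFSet.{u} => z ∈ Q ∧ y ∈ Q ∧ ZFSet.pair z y ∈ R := by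
    refine WellFounded.wellFounded_iff_has_min.2 fun s ⟨x, hx⟩ => ?_
    by_cases hxQ : x ∈ Q
    · have hx' : x ∈ ZFSet.sep (fun z => z ∈ s) Q := ZFSet.mem_sep.2 ⟨hxQ, hx⟩
      obtain ⟨y, hy, hmin⟩ := hwf (ZFSet.sep (fun z => z ∈ s) Q)
        (fun z hz => (ZFSet.mem_sep.1 hz).1) (fun e => by simp [e] at hx')
      exact ⟨y, (ZFSet.mem_sep.1 hy).2,
        fun z hz hzy => hmin z (ZFSet.mem_sep.2 ⟨hzy.1, hz⟩) hzy.2.2⟩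
    · exact ⟨x, hx, fun z _ hz => hxQ hz.2.1⟩
  refine ⟨wf.fix fun y ih => ZFSet.range
    fun z : ZFSet.sep (fun z => y ∈ Q ∧ ZFSet.pair z y ∈ R) Q =>
      ih z.1 ⟨(ZFSet.mem_sep.1 z.2).1, (ZFSet.mem_sep.1 z.2).2⟩, fun y w => ?_⟩
  rw [wf.fix_eq, ZFSet.mem_range]
  constructor
  · rintro ⟨⟨z, hz⟩, rfl⟩
    exact ⟨z, (ZFSet.mem_sep.1 hz).1, (ZFSet.mem_sep.1 hz).2, rfl⟩
  · rintro ⟨z, hz, hzy, rfl⟩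
    exact ⟨⟨z, ZFSet.mem_sep.2 ⟨hz, hzy⟩⟩, rfl⟩

theorem LimV.exists_list {δ : ZFSet.{u}} (hδ : LimV δ) {L t : ZFSet.{u}} (ht : t ∈ VBelow δ)
    (htL : t ⊆ L) (hf : FinIn (VBelow δ) t) :
    ∃ l : List ZFSet.{u}, (∀ ξ ∈ l, ξ ∈ L) ∧ t = ofList l := by
  obtain ⟨l, hl⟩ := (hδ.finIn_iff ht).1 hf
  exact ⟨l, fun ξ hξ => htL ((hl ξ).2 hξ), hl.eq_ofList⟩

namespace Seeds

variable {M : Set ZFSet.{u}} {j : ElemEmb (Set.univ : Set ZFSet.{u}) M} {L D : ZFSet.{u}}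
  {S : ZFSet.{u} → ZFSet.{u}} {δ : ZFSet.{u}}

theorem witDecided (h : Seeds j L D S) (hδ : LimV δ) (hL : L ∈ VBelow δ) (hD : D ∈ VBelow δ) :
    WitDecided (VBelow δ) (funcs L D) (seedFamily j L D S) L := by
  have hV := transClass_VBelow δ
  have hI := hδ.funcs_mem hL hD
  intro t ht htL hf X _ hXI hX
  obtain ⟨l, hl, rfl⟩ := hδ.exists_list ht htL hf
  have hs : SuppBy (funcs L D) l X := fun p hp q hq hpq =>
    hX p hp q hq ((agreeOn_iff_univ hV (hV _ hI p hp) (hV _ hI q hq)).2 hpq)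
  obtain ⟨p, hp, hpl⟩ := h.exists_fits hl
  by_cases hpX : p ∈ j.toFun X
  · exact .inl (mem_seedFamily.2 ⟨hXI, l, hl, hs, p, hpX, hpl⟩)
  · have hY : ∀ q ∈ funcs L D, ¬ q ∈ X → q ∈ zdiff (funcs L D) X :=
      fun q hq hqX => ZFSet.mem_sep.2 ⟨hq, hqX⟩
    refine .inr ⟨zdiff (funcs L D) X, mem_seedFamily.2 ⟨fun q hq => (ZFSet.mem_sep.1 hq).1, l, hl,
      fun q hq r hr hqr hqX => ZFSet.mem_sep.2 ⟨hr, fun hrX => (ZFSet.mem_sep.1 hqX).2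
        (hs r hr q hq hqr.symm hrX)⟩, p, ?_, hpl⟩, fun q hq => (ZFSet.mem_sep.1 hq).2⟩
    exact (j.transfer h.trans (n := 3) (fun _ _ v => ∀ q ∈ v 0, ¬ q ∈ v 1 → q ∈ v 2)
      ![funcs L D, X, zdiff (funcs L D) X]).1 hY p hp hpX

theorem witWf (h : Seeds j L D S) (hδ : LimV δ) (hL : L ∈ VBelow δ) (hD : D ∈ VBelow δ) :
    WitWf (VBelow δ) (funcs L D) (seedFamily j L D S) L := by
  have hV := transClass_VBelow δ
  have hI := hδ.funcs_mem hL hD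
  intro N hN R _ hwf hne hall
  have hQ := hδ.prod_mem hN hI
  obtain ⟨ρ, hρ⟩ := exists_rankFun (Q := ZFSet.prod N (funcs L D)) (R := R)
    fun Y hY => hwf Y (mem_VBelow_of_subset hY hQ)
  set r := graph (ZFSet.prod N (funcs L D)) ρ with hr
  have inv : ∀ n ∈ N, ∃ l : List ZFSet.{u}, (∀ ξ ∈ l, ξ ∈ L) ∧
      ∀ p ∈ funcs L D, ∀ q ∈ funcs L D, AgreeOn Set.univ (ofList l) p q →
        ∀ x ∈ Set.univ, ∀ a ∈ Set.univ, ∀ b ∈ Set.univ, a = ZFSet.pair n p → b = ZFSet.pair n q →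
          ZFSet.pair a x ∈ r → ZFSet.pair b x ∈ r := by
    intro n hn
    obtain ⟨⟨t, ht, htL, hf, hinv⟩, -⟩ := hall n hn
    obtain ⟨l, hl, rfl⟩ := hδ.exists_list ht htL hf
    refine ⟨l, hl, ?_⟩
    rintro p hp q hq hpq x - _ - _ - rfl rfl hx
    have key : ∀ p ∈ funcs L D, ∀ q ∈ funcs L D, AgreeOn Set.univ (ofList l) p q →
        ρ (ZFSet.pair n p) ⊆ ρ (ZFSet.pair n q) := by
      intro p hp q hq hpq w hw
      obtain ⟨z, hz, ⟨-, hzp⟩, rfl⟩ := (hρ _ _).1 hw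
      exact (hρ _ _).2 ⟨z, hz, ⟨ZFSet.pair_mem_prod.2 ⟨hn, hq⟩, hinv p hp q hq
        ((agreeOn_iff_univ hV (hV _ hI p hp) (hV _ hI q hq)).2 hpq) z (hV _ hQ z hz) _
        (hδ.pair_mem (hV _ hN n hn) (hV _ hI p hp)) _
        (hδ.pair_mem (hV _ hN n hn) (hV _ hI q hq)) rfl rfl hzp⟩, rfl⟩
    refine pair_mem_graph.2 ⟨ZFSet.pair_mem_prod.2 ⟨hn, hq⟩, (pair_mem_graph.1 hx).2.trans ?_⟩
    exact ZFSet.ext fun w => ⟨fun hw => key p hp q hq hpq hw, fun hw => key q hq p hp hpq.symm hw⟩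
  choose! l hl hinv using inv
  have main : ∀ x : ZFSet.{u}, ∀ n ∈ N, ∀ p ∈ j.toFun (funcs L D), Fits j S (l n) p →
      ¬ ZFSet.pair (ZFSet.pair (j.toFun n) p) x ∈ j.toFun r := by
    intro x
    induction x using ZFSet.inductionOn with
    | _ x ih =>
    intro n hn p hp hpl hx
    obtain ⟨-, m, hm, X, hX, hXR⟩ := hall n hn
    obtain ⟨k, hk, -, hkX⟩ := h.exists_support hX
    obtain ⟨q, hq, hql⟩ := h.exists_fits (l := l n ++ (l m ++ k)) (by
      intro ξ hξ
      rcases List.mem_append.1 hξ with hξ | hξ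
      · exact hl n hn ξ hξ
      · exact (List.mem_append.1 hξ).elim (hl m hm ξ) (hk ξ))
    obtain ⟨hqn, hqmk⟩ := fits_append.1 hql
    obtain ⟨hqm, hqk⟩ := fits_append.1 hqmk
    have hIM := j.mem (funcs L D)
    have hx' : ZFSet.pair (ZFSet.pair (j.toFun n) q) x ∈ j.toFun r :=
      (j.transfer h.trans (n := 4) (fun C _ v => ∀ p ∈ v 0, ∀ q ∈ v 0, AgreeOn C (v 1) p q →
        ∀ x ∈ C, ∀ a ∈ C, ∀ b ∈ C, a = ZFSet.pair (v 2) p → b = ZFSet.pair (v 2) q →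
          ZFSet.pair a x ∈ v 3 → ZFSet.pair b x ∈ v 3) ![funcs L D, ofList (l n), n, r]).1
        (hinv n hn) p hp q hq (h.agreeOn_of_fits (hl n hn) hp hq hpl hqn) x
        (h.trans.of_pair_mem (j.mem r) hx).2 _ (j.pair_mem h.trans (j.mem n) (h.trans _ hIM p hp))
        _ (j.pair_mem h.trans (j.mem n) (h.trans _ hIM q hq)) rfl rfl hx
    have step : ∀ p ∈ X, ∀ x ∈ Set.univ, ∀ b ∈ Set.univ, b = ZFSet.pair n p →
        ZFSet.pair b x ∈ r → ∃ y ∈ x, ∃ a ∈ Set.univ, a = ZFSet.pair m p ∧ ZFSet.pair a y ∈ r := by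
      rintro p hp x - _ - rfl hx
      have hpI := (mem_seedFamily.1 hX).1 hp
      obtain ⟨_, -, _, -, rfl, rfl, hab⟩ := hXR p hp
      have hmp : ZFSet.pair m p ∈ ZFSet.prod N (funcs L D) := ZFSet.pair_mem_prod.2 ⟨hm, hpI⟩
      refine ⟨ρ (ZFSet.pair m p), ?_, _, trivial, rfl, pair_mem_graph.2 ⟨hmp, rfl⟩⟩
      rw [(pair_mem_graph.1 hx).2]
      exact (hρ _ _).2 ⟨_, hmp, ⟨(pair_mem_graph.1 hx).1, hab⟩, rfl⟩
    obtain ⟨y, hy, _, -, rfl, hay⟩ := (j.transfer h.trans (n := 4) (fun C _ v => ∀ p ∈ v 0,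
      ∀ x ∈ C, ∀ b ∈ C, b = ZFSet.pair (v 1) p → ZFSet.pair b x ∈ v 3 →
        ∃ y ∈ x, ∃ a ∈ C, a = ZFSet.pair (v 2) p ∧ ZFSet.pair a y ∈ v 3) ![X, n, m, r]).1
      step q (hkX q hq hqk) x (h.trans.of_pair_mem (j.mem r) hx).2 _
      (j.pair_mem h.trans (j.mem n) (h.trans _ hIM q hq)) rfl hx'
    exact ih y hy m hm q hq hqm hay
  obtain ⟨n, hn⟩ : ∃ n, n ∈ N := by
    by_contra! e
    exact hne ((ZFSet.eq_empty N).2 e)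
  obtain ⟨p, hp, hpl⟩ := h.exists_fits (hl n hn)
  have tot : ∀ p ∈ funcs L D, ∃ x ∈ Set.univ, ∃ b ∈ Set.univ, b = ZFSet.pair n p ∧
      ZFSet.pair b x ∈ r := fun p hp => ⟨ρ (ZFSet.pair n p), trivial, _, trivial, rfl,
    pair_mem_graph.2 ⟨ZFSet.pair_mem_prod.2 ⟨hn, hp⟩, rfl⟩⟩
  obtain ⟨x, -, _, -, rfl, hx⟩ := (j.transfer h.trans (n := 3) (fun C _ v => ∀ p ∈ v 0, ∃ x ∈ C,
    ∃ b ∈ C, b = ZFSet.pair (v 1) p ∧ ZFSet.pair b x ∈ v 2) ![funcs L D, n, r]).1 tot p hp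
  exact main x n hn p hp hpl hx

end Seeds

theorem app_mem_of_mem_funcs {L D p ξ : ZFSet.{u}} (hp : p ∈ funcs L D) (hξ : ξ ∈ L) :
    app p ξ ∈ D := (mem_funcs.1 hp).2 _ _ ((mem_funcs.1 hp).1.pair_app hξ)

theorem CardLtIn.subset {s s' κ : ZFSet.{u}} (h : CardLtIn Set.univ s κ) (hs : s' ⊆ s) :
    CardLtIn Set.univ s' κ := by
  obtain ⟨β, f, hβ, -, hf, hfβ, hi⟩ := h
  refine ⟨β, graph s' (app f), hβ, trivial, isFuncOn_graph _ _, fun x y hxy => ?_,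
    fun x x' y hx hx' => ?_⟩
  · obtain ⟨hx, rfl⟩ := pair_mem_graph.1 hxy
    exact hfβ _ _ (hf.pair_app (hs hx))
  · obtain ⟨hxs, rfl⟩ := pair_mem_graph.1 hx
    obtain ⟨hxs', e⟩ := pair_mem_graph.1 hx'
    exact hi _ _ _ (hf.pair_app (hs hxs)) (e ▸ hf.pair_app (hs hxs'))

namespace Seeds

variable {M : Set ZFSet.{u}} {j : ElemEmb (Set.univ : Set ZFSet.{u}) M} {L D : ZFSet.{u}}
  {S : ZFSet.{u} → ZFSet.{u}} {δ lam : ZFSet.{u}}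

/-- If the seed at `ξ` satisfies `P` in the sense of `M`, then `P` holds almost everywhere. -/
theorem eventually_app (h : Seeds j L D S) {ξ : ZFSet.{u}} (hξ : ξ ∈ L) (P : ZFSet.{u} → Prop)
    (hP : ∀ W, (∀ z ∈ D, P z → z ∈ W) → S ξ ∈ j.toFun W) : ∃ X ∈ seedFamily j L D S, ∀ p ∈ X,
      p ∈ funcs L D ∧ ZFSet.pair ξ (app p ξ) ∈ p ∧ app p ξ ∈ D ∧ P (app p ξ) := by
  obtain ⟨X, hX, hXW⟩ := h.eventually_mem (W := ZFSet.sep P D) hξ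
    (hP _ fun z hz hPz => ZFSet.mem_sep.2 ⟨hz, hPz⟩)
  refine ⟨X, hX, fun p hp => ?_⟩
  have hpI := (mem_seedFamily.1 hX).1 hp
  exact ⟨hpI, (mem_funcs.1 hpI).1.pair_app hξ, ZFSet.mem_sep.1 (hXW p hp)⟩

theorem witProj (h : Seeds j L D S) (hδ : LimV δ) (hL : L ∈ VBelow δ) (hD : D ∈ VBelow δ)
    (hlam : IsOrd lam) (hS : ∀ ξ, oLe ξ lam → ξ ∈ L ∧ S ξ = ξ) :
    WitProj (VBelow δ) lam (funcs L D) (seedFamily j L D S) L := by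
  have hV := transClass_VBelow δ
  have hI := hδ.funcs_mem hL hD
  intro ξ _ hξ
  obtain ⟨hξL, hSξ⟩ := hS ξ hξ
  have hlt : ∀ η ∈ ξ, η ∈ lam := fun η hη => hξ.elim (fun hξ => hlam.1 ξ hξ hη) (fun e => e ▸ hη)
  refine ⟨fun η hη => ?_, fun f hf hfI ⟨t, ht, htL, hft, hinv⟩ ⟨X, hX, hXξ⟩ => ?_⟩
  · obtain ⟨hηL, hSη⟩ := hS η (.inl (hlt η hη))
    set W := ZFSet.sep (fun w => ∃ y z, w = ZFSet.pair y z ∧ y ∈ z) (ZFSet.prod D D)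
    have hW : ∀ y ∈ D, ∀ z ∈ D, y ∈ z → ZFSet.pair y z ∈ W := fun
      y hy z hz hyz => ZFSet.mem_sep.2 ⟨ZFSet.pair_mem_prod.2 ⟨hy, hz⟩, y, z, rfl, hyz⟩
    obtain ⟨X, hX, hXW⟩ := h.eventually_pair (W := W) hηL hξL
      ((j.transfer h.trans (n := 2) (fun _ _ v => ∀ y ∈ v 0, ∀ z ∈ v 0, y ∈ z →
        ZFSet.pair y z ∈ v 1) ![D, W]).1 hW _ (h.seed_mem η hηL) _ (h.seed_mem ξ hξL)
          (by rwa [hSη, hSξ]))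
    refine ⟨X, hX, fun p hp => ?_⟩
    have hpI := (mem_seedFamily.1 hX).1 hp
    obtain ⟨-, y, z, e, hyz⟩ := ZFSet.mem_sep.1 (hXW p hp)
    obtain ⟨rfl, rfl⟩ := ZFSet.pair_inj.1 e
    exact ⟨_, hV _ hD _ (app_mem_of_mem_funcs hpI hηL), _, hV _ hD _ (app_mem_of_mem_funcs hpI hξL),
      (mem_funcs.1 hpI).1.pair_app hηL, (mem_funcs.1 hpI).1.pair_app hξL, hyz⟩
  · obtain ⟨l, hl, rfl⟩ := hδ.exists_list ht htL hft
    obtain ⟨k, hk, -, hkX⟩ := h.exists_support hX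
    obtain ⟨p, hp, hpl⟩ := h.exists_fits (l := ξ :: (l ++ k)) (by
      intro ζ hζ
      rcases List.mem_cons.1 hζ with rfl | hζ
      · exact hξL
      · exact (List.mem_append.1 hζ).elim (hl ζ) (hk ζ))
    obtain ⟨hpξ, hplk⟩ := fits_cons.1 hpl
    obtain ⟨hpl, hpk⟩ := fits_append.1 hplk
    have hXξ' : ∀ p ∈ X, ∃ y ∈ Set.univ, ∃ z ∈ Set.univ, ZFSet.pair p y ∈ f ∧
        ZFSet.pair ξ z ∈ p ∧ y ∈ z := fun p hp => by
      obtain ⟨y, -, z, -, hyz⟩ := hXξ p hp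
      exact ⟨y, trivial, z, trivial, hyz⟩
    obtain ⟨η, hηM, z, -, hpη, hpz, hηz⟩ := (j.transfer h.trans (n := 3) (fun C _ v => ∀ p ∈ v 0,
      ∃ y ∈ C, ∃ z ∈ C, ZFSet.pair p y ∈ v 1 ∧ ZFSet.pair (v 2) z ∈ p ∧ y ∈ z) ![X, f, ξ]).1
      hXξ' p (hkX p hp hpk)
    rw [h.eq_seed hp hξL hpξ hpz, hSξ] at hηz
    obtain ⟨hηL, hSη⟩ := hS η (.inl (hlt η hηz))
    set Y := ZFSet.sep (fun q => ZFSet.pair q (app q η) ∈ f) (funcs L D)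
    have hinv' : ∀ p ∈ funcs L D, ∀ q ∈ funcs L D, AgreeOn Set.univ (ofList l) p q →
        ∀ y ∈ Set.univ, ZFSet.pair p y ∈ f → ZFSet.pair q y ∈ f := fun p hp q hq hpq y _ hy =>
      hinv p hp q hq ((agreeOn_iff_univ hV (hV _ hI p hp) (hV _ hI q hq)).2 hpq) y
        (hV.of_pair_mem hf hy).2 hy
    refine ⟨η, hηz, Y, h.mem_seedFamily_of_fits (l := η :: l) ?_
      (fun q hq => (ZFSet.mem_sep.1 hq).1) ?_ ?_, ?_⟩
    · intro ζ hζ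
      rcases List.mem_cons.1 hζ with rfl | hζ
      exacts [hηL, hl ζ hζ]
    · intro q hq r hr hqr hqY
      refine ZFSet.mem_sep.2 ⟨hr, ?_⟩
      have e : app r η = app q η := ((mem_funcs.1 hq).1.pair_mem_iff hηL).1
        ((hqr η ((listedBy_ofList _ _).2 (by simp)) _ trivial).2 ((mem_funcs.1 hr).1.pair_app hηL))
      rw [e]
      refine hinv' q hq r hr (hqr.mono fun ζ hζ => ?_) _ trivial (ZFSet.mem_sep.1 hqY).2
      exact (listedBy_ofList _ _).2 (List.mem_cons_of_mem _ ((listedBy_ofList _ _).1 hζ))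
    · intro q hq hql
      obtain ⟨hqη, hql⟩ := fits_cons.1 hql
      have hqf := (j.transfer h.trans (n := 3) (fun C _ v => ∀ p ∈ v 0, ∀ q ∈ v 0,
        AgreeOn C (v 1) p q → ∀ y ∈ C, ZFSet.pair p y ∈ v 2 → ZFSet.pair q y ∈ v 2)
        ![funcs L D, ofList l, f]).1 hinv' p hp q hq (h.agreeOn_of_fits hl hp hq hpl hql) η hηM hpη
      have hY : ∀ q ∈ funcs L D, ∀ y ∈ Set.univ, ZFSet.pair q y ∈ f → ZFSet.pair η y ∈ q →
          q ∈ Y := by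
        intro q hq y _ hqy hηy
        refine ZFSet.mem_sep.2 ⟨hq, ?_⟩
        rwa [← ((mem_funcs.1 hq).1.pair_mem_iff hηL).1 hηy]
      rw [hSη] at hqη
      exact (j.transfer h.trans (n := 4) (fun C _ v => ∀ q ∈ v 0, ∀ y ∈ C, ZFSet.pair q y ∈ v 1 →
        ZFSet.pair (v 2) y ∈ q → q ∈ v 3) ![funcs L D, f, η, Y]).1 hY q hq η hηM hqf hqη
    · intro q hq
      obtain ⟨hqI, hqf⟩ := ZFSet.mem_sep.1 hq
      exact ⟨_, hV _ hD _ (app_mem_of_mem_funcs hqI hηL), hqf, (mem_funcs.1 hqI).1.pair_app hηL⟩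

end Seeds

namespace Seeds

variable {M : Set ZFSet.{u}} {j : ElemEmb (Set.univ : Set ZFSet.{u}) M} {L D : ZFSet.{u}}
  {S : ZFSet.{u} → ZFSet.{u}}

theorem witBase (h : Seeds j L D S) {κ lam st : ZFSet.{u}}
    (hL : ∀ x ∈ L, x ∈ lam ∨ x = lam ∨ x = st) (hst : st ∈ L)
    (hS : ∀ ξ, oLe ξ lam → ξ ∈ L ∧ S ξ = ξ) (hκ : ∀ α ∈ κ, α ∈ lam ∧ j.toFun α = α) :
    WitBase κ lam (funcs L D) (seedFamily j L D S) L st := by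
  refine ⟨fun p hp => (mem_funcs.1 hp).1, hL, fun ξ hξ => (hS ξ (.inl hξ)).1, (hS lam (.inr rfl)).1,
    hst, ⟨funcs L D, ?_, fun _ => id⟩, fun X hX => ⟨(mem_seedFamily.1 hX).1, ?_⟩,
    fun X hX Y hY => ?_, fun α hα => ?_⟩
  · exact h.mem_seedFamily_of_fits (l := []) (by simp) (fun _ => id)
      (fun p _ q hq _ _ => hq) (fun p hp _ => hp)
  · rintro rfl
    obtain ⟨-, l, -, -, p, hp, -⟩ := mem_seedFamily.1 hX
    rw [j.map_empty h.trans] at hp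
    exact ZFSet.notMem_empty p hp
  · obtain ⟨l, hl, hlX, hX'⟩ := h.exists_support hX
    obtain ⟨k, hk, hkY, hY'⟩ := h.exists_support hY
    refine ⟨X ∩ Y, h.mem_seedFamily_of_fits (l := l ++ k)
      (fun ξ hξ => (List.mem_append.1 hξ).elim (hl ξ) (hk ξ))
      (fun p hp => (mem_seedFamily.1 hX).1 (ZFSet.mem_inter.1 hp).1) ?_ ?_,
      fun p hp => (ZFSet.mem_inter.1 hp).1, fun p hp => (ZFSet.mem_inter.1 hp).2⟩
    · intro p hp q hq hpq hpXY
      rw [ofList_append] at hpq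
      exact ZFSet.mem_inter.2
        ⟨hlX p hp q hq (hpq.mono fun ξ hξ => ZFSet.mem_union.2 (.inl hξ)) (ZFSet.mem_inter.1 hpXY).1,
          hkY p hp q hq (hpq.mono fun ξ hξ => ZFSet.mem_union.2 (.inr hξ))
            (ZFSet.mem_inter.1 hpXY).2⟩
    · intro p hp hpl
      obtain ⟨hpl, hpk⟩ := fits_append.1 hpl
      exact (j.transfer h.trans (n := 3) (fun _ _ v => ∀ p ∈ v 0, p ∈ v 1 → p ∈ v 2)
        ![X, Y, X ∩ Y]).1 (fun p hp hp' => ZFSet.mem_inter.2 ⟨hp, hp'⟩) p (hX' p hp hpl)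
        (hY' p hp hpk)
  · obtain ⟨hα, e⟩ := hκ α hα
    obtain ⟨hαL, hSα⟩ := hS α (.inl hα)
    obtain ⟨X, hX, hXW⟩ := h.eventually_mem (W := {α}) hαL (by
      have := (j.mem_iff h.trans).2 (ZFSet.mem_singleton.2 (rfl : α = α))
      rw [e] at this
      rwa [hSα])
    refine ⟨X, hX, fun p hp => ?_⟩
    have := (mem_funcs.1 ((mem_seedFamily.1 hX).1 hp)).1.pair_app hαL
    rwa [ZFSet.mem_singleton.1 (hXW p hp)] at this

theorem witCover (h : Seeds j L D S) {δ κ lam st : ZFSet.{u}} {B : Set ZFSet.{u}} (hδ : LimV δ)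
    (hδo : IsOrd δ) (hD : D ∈ VBelow δ) (hκδ : κ ∈ VBelow δ) (hlam : IsOrd lam) (hst : st ∈ L)
    (hS : ∀ ξ, oLe ξ lam → ξ ∈ L ∧ S ξ = ξ) (hj : lam ∈ j.toFun κ) (hκD : κ ⊆ D)
    (hsub : ∀ α ∈ lam, j.toFun α ∈ S st) (hcard : CardLtIn M (S st) (j.toFun κ))
    (hB : AgreeMem lam (ZFSet.sep (fun x => x ∈ B) δ)
      (j.toFun (ZFSet.sep (fun x => x ∈ B) δ))) (hlamδ : lam ⊆ δ) :
    WitCover (VBelow δ) B κ lam (seedFamily j L D S) st := by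
  have hV := transClass_VBelow δ
  set A := ZFSet.sep (fun x => x ∈ B) δ with hA
  refine ⟨fun ξ hξ hξB => ?_, fun ξ hξ hξB => ?_, ?_, fun α hα => ?_, ?_⟩
  · obtain ⟨hξL, hSξ⟩ := hS ξ (.inl hξ)
    obtain ⟨X, hX, hXP⟩ := h.eventually_app hξL (fun z => z ∈ A) fun W hW => by
      refine (j.transfer h.trans (n := 3) (fun _ _ v => ∀ z ∈ v 0, z ∈ v 1 → z ∈ v 2)
        ![D, A, W]).1 hW _ (h.seed_mem ξ hξL) ?_
      rw [hSξ]
      exact (hB ξ hξ).1 (ZFSet.mem_sep.2 ⟨hlamδ hξ, hξB⟩)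
    refine ⟨X, hX, fun p hp => ?_⟩
    obtain ⟨-, h1, h2, h3⟩ := hXP p hp
    exact ⟨_, hV _ hD _ h2, h1, (ZFSet.mem_sep.1 h3).2⟩
  · obtain ⟨hξL, hSξ⟩ := hS ξ (.inl hξ)
    obtain ⟨X, hX, hXP⟩ := h.eventually_app hξL (fun z => IsOrd z ∧ ¬ z ∈ A) fun W hW => by
      refine (j.transfer h.trans (n := 3) (fun _ _ v => ∀ z ∈ v 0, IsOrd z ∧ ¬ z ∈ v 1 → z ∈ v 2)
        ![D, A, W]).1 hW _ (h.seed_mem ξ hξL) ?_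
      rw [hSξ]
      exact ⟨hlam.mem hξ, fun hξA => hξB (ZFSet.mem_sep.1 ((hB ξ hξ).2 hξA)).2⟩
    refine ⟨X, hX, fun p hp => ?_⟩
    obtain ⟨-, h1, h2, h3, h4⟩ := hXP p hp
    exact ⟨_, hV _ hD _ h2, h1, fun hb =>
      h4 (ZFSet.mem_sep.2 ⟨hδo.mem_of_mem_VBelow h3 (hV _ hD _ h2), hb⟩)⟩
  · obtain ⟨hξL, hSξ⟩ := hS lam (.inr rfl)
    obtain ⟨X, hX, hXP⟩ := h.eventually_app hξL (fun z => z ∈ κ) fun W hW => by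
      refine (j.transfer h.trans (n := 2) (fun _ _ v => v 0 ⊆ v 1)
        ![κ, W]).1 (fun z hz => hW z (hκD hz) hz) ?_
      rw [hSξ]
      exact hj
    refine ⟨X, hX, fun p hp => ?_⟩
    obtain ⟨-, h1, h2, h3⟩ := hXP p hp
    exact ⟨_, hV _ hD _ h2, h1, h3⟩
  · obtain ⟨X, hX, hXP⟩ := h.eventually_app hst (fun z => α ∈ z) fun W hW =>
      (j.transfer h.trans (n := 3) (fun _ _ v => ∀ z ∈ v 0, v 1 ∈ z → z ∈ v 2)
        ![D, α, W]).1 hW _ (h.seed_mem st hst) (hsub α hα)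
    refine ⟨X, hX, fun p hp => ?_⟩
    obtain ⟨-, h1, h2, h3⟩ := hXP p hp
    exact ⟨_, hV _ hD _ h2, h1, h3⟩
  · obtain ⟨X, hX, hXP⟩ := h.eventually_app hst (fun z => CardLtIn Set.univ z κ) fun W hW =>
      (j.transfer h.trans (n := 3) (fun C _ v => ∀ z ∈ v 0, CardLtIn C z (v 1) → z ∈ v 2)
        ![D, κ, W]).1 hW _ (h.seed_mem st hst) hcard
    refine ⟨X, hX, fun p hp => ?_⟩
    obtain ⟨-, h1, h2, h3⟩ := hXP p hp
    exact ⟨_, hV _ hD _ h2, h1, (hδ.cardLtIn_iff (hV _ hD _ h2) hκδ).2 h3⟩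

end Seeds

theorem CoversIn.exists_cover {M : Set ZFSet.{u}} {j : ElemEmb (Set.univ : Set ZFSet.{u}) M}
    {κ lam : ZFSet.{u}} (hM : TransClass M) (h : CoversIn Set.univ M j.toFun κ lam) :
    ∃ s ∈ M, s ⊆ j.toFun lam ∧ (∀ α ∈ lam, j.toFun α ∈ s) ∧ CardLtIn M s (j.toFun κ) := by
  set X := ZFSet.range fun a : lam => j.toFun a.1 with hXdef
  have hX : ∀ x, x ∈ X ↔ ∃ a ∈ lam, j.toFun a = x := fun x => by simp [hXdef, ZFSet.mem_range]
  have hle : X.card ≤ lam.card := by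
    choose! F hF using fun x hx => (hX x).1 hx
    exact card_le_of_injOn F (fun x hx => (hF x hx).1) fun x hx y hy e => by
      rw [← (hF x hx).2, ← (hF y hy).2, e]
  obtain ⟨s, hs, hXs, hcard⟩ := h X trivial (fun x hx => by
    obtain ⟨a, -, rfl⟩ := (hX x).1 hx
    exact j.mem a) (setLeIn_univ_iff.2 hle)
  refine ⟨s ∩ j.toFun lam, j.inter_mem hM hs (j.mem lam), fun x hx => (ZFSet.mem_inter.1 hx).2,
    fun α hα => ZFSet.mem_inter.2 ⟨hXs ((hX _).2 ⟨α, hα, rfl⟩), (j.mem_iff hM).2 hα⟩, ?_⟩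
  exact (j.transfer hM (n := 1) (fun C _ v => ∀ s ∈ C, ∀ s' ∈ C, CardLtIn C s (v 0) → s' ⊆ s →
    CardLtIn C s' (v 0)) ![κ]).1 (fun s _ s' _ h h' => h.subset h') s hs _
    (j.inter_mem hM hs (j.mem lam)) hcard fun x hx => (ZFSet.mem_inter.1 hx).1

/-- A strong compactness embedding can be coded in `V_δ`. -/
theorem LamSCForIn.exists_wit {δ κ lam : ZFSet.{u}} {B : Set ZFSet.{u}} (hδ : LimV δ)
    (hδo : IsOrd δ) (hlamδ : lam ∈ δ) (hle : oLe κ lam)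
    (h : LamSCFor κ lam (ZFSet.sep (fun x => x ∈ B) δ)) :
    ∃ I ∈ VBelow δ, ∃ U ∈ VBelow δ, ∃ L ∈ VBelow δ, ∃ st ∈ VBelow δ,
      Wit (VBelow δ) B κ lam I U L st := by
  classical
  obtain ⟨M, -, hM, j, hκ, hj, hcov, hA⟩ := h
  obtain ⟨s, hs, hsl, hsub, hcard⟩ := hcov.exists_cover hM
  have hlam : IsOrd lam := hδo.mem hlamδ
  have hlamV := mem_VBelow_of_mem hlamδ
  have hκV : κ ∈ VBelow δ := hle.elim (transClass_VBelow δ _ hlamV κ) (fun e => e ▸ hlamV)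
  have hκl : κ ⊆ lam := fun α hα => hle.elim (fun h => hlam.1 κ h hα) (fun e => e ▸ hα)
  have hjl : IsOrd (j.toFun lam) := (j.isOrd hM).2 hlam
  have hlj : lam ∈ j.toFun lam := by
    rcases hle with hle | rfl
    · exact hjl.1 _ ((j.mem_iff hM).2 hle) hj
    · exact hj
  set st : ZFSet.{u} := insert lam lam with hst
  set L : ZFSet.{u} := insert st st with hL
  set D := lam.powerset with hD
  set S : ZFSet.{u} → ZFSet.{u} := fun ξ => if ξ = st then s else ξ with hSdef
  have hstV : st ∈ VBelow δ := hδ.insert_mem hlamV hlamV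
  have hLV : L ∈ VBelow δ := hδ.insert_mem hstV hstV
  have hDV : D ∈ VBelow δ := hδ.powerset_mem hlamV
  have hstL : st ∈ L := by simp [hL]
  have hmem : ∀ x ∈ L, x ∈ lam ∨ x = lam ∨ x = st := fun x hx => by
    rcases ZFSet.mem_insert_iff.1 hx with rfl | hx
    · exact .inr (.inr rfl)
    · exact (ZFSet.mem_insert_iff.1 hx).elim (fun e => .inr (.inl e)) .inl
  have hS : ∀ ξ, oLe ξ lam → ξ ∈ L ∧ S ξ = ξ := fun ξ hξ => by
    have h1 : ξ ∈ st := ZFSet.mem_insert_iff.2 hξ.symm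
    refine ⟨ZFSet.mem_insert_iff.2 (.inr h1), if_neg ?_⟩
    rintro rfl
    exact ZFSet.mem_irrefl _ h1
  have hSst : S st = s := if_pos rfl
  have hjD : ∀ x ∈ M, x ⊆ j.toFun lam → x ∈ j.toFun D :=
    (j.transfer hM (n := 2) (fun C _ v => ∀ x ∈ C, x ⊆ v 0 → x ∈ v 1) ![lam, D]).1
      fun x _ hx => ZFSet.mem_powerset.2 hx
  have hseed : Seeds j L D S := by
    refine ⟨hM, by simp [hD], fun ξ hξ => ?_⟩
    have key : oLe ξ lam → S ξ ∈ j.toFun D := fun h => by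
      rw [(hS ξ h).2]
      have : ξ ∈ j.toFun lam := h.elim (hjl.1 _ hlj ·) (fun e => e ▸ hlj)
      exact hjD ξ (hM _ (j.mem lam) ξ this) (hjl.1 ξ this)
    rcases hmem ξ hξ with h | h | rfl
    · exact key (.inl h)
    · exact key (.inr h)
    · rw [hSst]
      exact hjD s hs hsl
  have hU : seedFamily j L D S ∈ VBelow δ := mem_VBelow_of_subset
    (fun X hX => (ZFSet.mem_sep.1 hX).1) (hδ.powerset_mem (hδ.funcs_mem hLV hDV))
  exact ⟨funcs L D, hδ.funcs_mem hLV hDV, seedFamily j L D S, hU, L, hLV, st, hstV,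
    hseed.witBase hmem hstL hS fun α hα => ⟨hκl hα, hκ.2.2 α hα⟩,
    hseed.witDecided hδ hLV hDV, hseed.witWf hδ hLV hDV, hseed.witProj hδ hLV hDV hlam hS,
    hseed.witCover hδ hδo hDV hκV hlam hstL hS hj
      (fun α hα => ZFSet.mem_powerset.2 (hlam.1 α (hκl hα))) (hSst ▸ hsub) (hSst ▸ hcard) hA
      (hδo.1 lam hlamδ)⟩

theorem WoodinSCIn.om_mem {δ : ZFSet.{u}} (h : WoodinSC δ) : om ∈ δ := by
  obtain ⟨κ, hκ, hκδ⟩ := h.2 ∅ trivial (ZFSet.empty_subset δ)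
  obtain ⟨M, -, hM, j, hj, -⟩ := hκδ κ (.inr rfl) hκ
  exact h.1.1.1 κ hκ (hj.om_mem hM)

theorem WoodinSCIn.woodinBody {δ : ZFSet.{u}} (h : WoodinSC δ) (B : Set ZFSet.{u}) :
    WoodinBody (VBelow δ) B := by
  have hδ := limV_of_isCard h.1 h.om_mem
  have hδo := h.1.1
  refine ⟨hδ, ⟨om, mem_VBelow_of_mem h.om_mem, isOm_om.1, isOm_om.2.1⟩, ?_, ?_⟩
  · rintro β hβ hβo ⟨h1, h2⟩
    choose! F hF hFB using fun x (hx : x ∈ δ) => h1 x (mem_VBelow_of_mem hx) (hδo.mem hx)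
    refine h.1.2 β (hδo.mem_of_mem_VBelow hβo hβ) (setLeIn_univ_iff.2
      (card_le_of_injOn F hF fun x hx y hy e => ?_))
    obtain ⟨z, hz, rfl, hzB⟩ := hFB x hx
    obtain ⟨z', hz', rfl, hzB'⟩ := hFB y hy
    exact h2 x (mem_VBelow_of_mem hx) y (mem_VBelow_of_mem hy) (F x)
      (transClass_VBelow δ _ hβ _ (hF x hx)) _ hz _ hz' rfl (by rw [e]) hzB hzB'
  · obtain ⟨κ, hκ, hκδ⟩ := h.2 (ZFSet.sep (fun x => x ∈ B) δ) trivial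
      fun x hx => (ZFSet.mem_sep.1 hx).1
    refine ⟨κ, mem_VBelow_of_mem hκ, hδo.mem hκ, fun lam hlam hlamo hle => ?_⟩
    have hlamδ := hδo.mem_of_mem_VBelow hlamo hlam
    exact (hκδ lam hle hlamδ).exists_wit hδ hδo hlamδ hle

theorem woodinSC_of_woodinBody {δ : ZFSet.{u}} (hδo : IsOrd δ)
    (h : ∀ B : Set ZFSet.{u}, B ⊆ VBelow δ → WoodinBody (VBelow δ) B) : WoodinSC δ := by
  obtain ⟨hδ, ⟨w, hw, h0, hs⟩, -⟩ := h ∅ (Set.empty_subset _)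
  replace hδ : LimV δ := hδ
  have hom : om ∈ VBelow δ := mem_VBelow_of_subset (isOm_om.subset h0 hs) hw
  refine ⟨⟨hδo, ?_⟩, fun A _ hA => ?_⟩
  · rintro β hβ ⟨f, -, hf, hfβ, hi⟩
    refine (h {z | z ∈ f} fun z hz => ?_).2.2.1 β (mem_VBelow_of_mem hβ) (hδo.mem hβ)
      ⟨fun x hx hxo => ?_, ?_⟩
    · obtain ⟨a, b, ha, rfl⟩ := hf.1 z hz
      exact hδ.pair_mem (mem_VBelow_of_mem ha)
        (mem_VBelow_of_mem (hδo.1 β hβ (hfβ _ _ hz)))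
    · have hp := hf.pair_app (hδo.mem_of_mem_VBelow hxo hx)
      have hy := hfβ _ _ hp
      exact ⟨_, hy, _, hδ.pair_mem hx (mem_VBelow_of_mem (hδo.1 β hβ hy)), rfl, hp⟩
    · rintro x - x' - y - _ - _ - rfl rfl hz hz'
      exact hi x x' y hz hz'
  · obtain ⟨-, -, -, κ, hκ, hκo, hκδ⟩ := h {x | x ∈ A} fun x hx => mem_VBelow_of_mem (hA hx)
    refine ⟨κ, hδo.mem_of_mem_VBelow hκo hκ, fun lam hle hlam => ?_⟩
    obtain ⟨I, hI, U, hU, L, hL, st, hst, hwit⟩ :=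
      hκδ lam (mem_VBelow_of_mem hlam) (hδo.mem hlam) hle
    exact IsCode.lamSCFor ⟨hδ, hom, hI, hL, hwit⟩ (hδo.mem hlam) hκo hle hκ fun x => Iff.rfl

/-- Woodin for strong compactness is `Π¹₁` over `V_δ`, uniformly in the ordinal `δ`. -/
theorem exists_pi11_woodinSC : ∃ φ : Fml2 0, ∀ δ : ZFSet.{u}, IsOrd δ → ∀ A : Set ZFSet.{u},
    (WoodinSC δ ↔ ∀ B : Set ZFSet.{u}, B ⊆ VBelow δ →
      Fml2.Realize (VBelow δ) A B φ (fun i => i.elim0)) := by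
  obtain ⟨φ, hφ⟩ := definable_woodinBody.{u}.out
  refine ⟨φ, fun δ hδ A => ?_⟩
  have key := fun B => hφ (VBelow δ) A B (fun i => i.elim0) (transClass_VBelow δ) fun i => i.elim0
  exact ⟨fun h B _ => (key B).2 (h.woodinBody B),
    fun h => woodinSC_of_woodinBody hδ fun B hB => (key B).1 (h B hB)⟩

/-- **Proposition.**  Woodin for strong compactness is a Π¹₁-definable property
over `V_δ`; consequently the first Woodin for strong compactness cardinal is
not weakly compact. -/
theorem wsc_pi11_first_not_weakly_compact :
    (∃ φ : Fml2 0, ∀ δ : ZFSet, IsCard δ →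
      (WoodinSC δ ↔ ∀ A B : Set ZFSet, A ⊆ VBelow δ → B ⊆ VBelow δ →
        Fml2.Realize (VBelow δ) A B φ (fun i => i.elim0))) ∧
    (∀ δ : ZFSet, WoodinSC δ → (∀ γ ∈ δ, ¬ WoodinSC γ) → ¬ WeaklyCompact δ) := by
  constructor
  · obtain ⟨φ, hφ⟩ := exists_pi11_woodinSC
    exact ⟨φ, fun δ hδ => ⟨fun h A B _ => (hφ δ hδ.1 A).1 h B,
      fun h => (hφ δ hδ.1 ∅).2 fun B => h ∅ B (Set.empty_subset _)⟩⟩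
  · obtain ⟨φ, hφ⟩ := exists_pi11_woodinSC
    intro δ hδ hmin hwc
    obtain ⟨α, hα, hαδ, hr⟩ := hwc.2 ∅ φ (Set.empty_subset _) ((hφ δ hδ.1.1 ∅).1 hδ)
    exact hmin α (hδ.1.1.mem_of_mem_VBelow hα hαδ) ((hφ α hα _).2 hr)

end WSC
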